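/- arXiv:1803.00715 — 4 statements merged into one kernel-verified Lean document; each statement's English description precedes it below -/
import Mathlib

section
/- Let P, Q be Borel probability measures on ℝ^d satisfying the continuity assumption (so that the mixture ν = (1/2)P + (1/2)Q is atomless), let ϑ ∈ (0,1), and let ρ_Angle be the angular distance built from ν, i.e. ρ_Angle(z, z') = (1/π)∫ Ang(z − w, z' − w) dν(w). Then 2·W_d²(P,Q) = 2 ∫∫ ρ_Angle(x, y) dP(x) dQ(y) − ∫∫ ρ_Angle(x1, x2) dP(x1) dP(x2) − ∫∫ ρ_Angle(y1, y2) dQ(y1) dQ(y2). -/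
open MeasureTheory ProbabilityTheory Real
open scoped RealInnerProductSpace ENNReal BigOperators

noncomputable section

/-- The standard Gaussian measure on `ℝ^d = EuclideanSpace ℝ (Fin d)`. -/
def stdGaussian (d : ℕ) : Measure (EuclideanSpace ℝ (Fin d)) :=
  (Measure.pi fun _ : Fin d => gaussianReal 0 1).map
    ⇑(EuclideanSpace.equiv (Fin d) ℝ).symm

/-- The uniform (rotation-invariant) probability measure `λ` on the unit sphere
`S^{d-1} = {x : ‖x‖ = 1} ⊆ ℝ^d`, realized as a Borel measure on `ℝ^d` concentrated
on the sphere: the pushforward of the standard Gaussian under `x ↦ ‖x‖⁻¹ • x`. -/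
def sphereUniform (d : ℕ) : Measure (EuclideanSpace ℝ (Fin d)) :=
  (stdGaussian d).map fun x => ‖x‖⁻¹ • x

/-- `Ang u v = arccos (⟪u,v⟫ / (‖u‖ ‖v‖)) ∈ [0, π]`, the angle between two nonzero vectors. -/
def Ang {d : ℕ} (u v : EuclideanSpace ℝ (Fin d)) : ℝ :=
  Real.arccos (⟪u, v⟫ / (‖u‖ * ‖v‖))

/-- Law of the projection `x ↦ ⟪β, x⟫` under `P`. -/
def projLaw {d : ℕ} (P : Measure (EuclideanSpace ℝ (Fin d)))
    (β : EuclideanSpace ℝ (Fin d)) : Measure ℝ :=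
  P.map fun x => ⟪β, x⟫

/-- `F_{β,P}(t) = P {x : ⟪β,x⟫ ≤ t}`. -/
def projCDF {d : ℕ} (P : Measure (EuclideanSpace ℝ (Fin d)))
    (β : EuclideanSpace ℝ (Fin d)) (t : ℝ) : ℝ :=
  (P {x | ⟪β, x⟫ ≤ t}).toReal

/-- The squared Cramér–von Mises distance `W_d²(P,Q)` with weight `ϑ`:
`∫_{S^{d-1}} ∫_ℝ (F_{β,P}(t) - F_{β,Q}(t))² dH_β(t) dλ(β)` where `H_β` is the law of
`x ↦ ⟪β,x⟫` under the mixture `ϑ•P + (1-ϑ)•Q`. -/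
def cvmSq {d : ℕ} (ϑ : ℝ) (P Q : Measure (EuclideanSpace ℝ (Fin d))) : ℝ :=
  ∫ β, (∫ t, (projCDF P β t - projCDF Q β t) ^ 2
      ∂(projLaw (ENNReal.ofReal ϑ • P + ENNReal.ofReal (1 - ϑ) • Q) β))
    ∂(sphereUniform d)

/-- The continuity assumption: for `λ`-a.e. `β`, the pushforwards of `P` and `Q`
under `x ↦ ⟪β,x⟫` are atomless. -/
def ContinuityAssumption {d : ℕ} (P Q : Measure (EuclideanSpace ℝ (Fin d))) : Prop :=
  ∀ᵐ β ∂(sphereUniform d),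
    (∀ t : ℝ, projLaw P β {t} = 0) ∧ (∀ t : ℝ, projLaw Q β {t} = 0)

/-- The angular distance built from `ν`: `ρ_Angle(z,z') = (1/π) ∫ Ang(z-w, z'-w) dν(w)`. -/
def angDist {d : ℕ} (ν : Measure (EuclideanSpace ℝ (Fin d)))
    (z z' : EuclideanSpace ℝ (Fin d)) : ℝ :=
  (1 / π) * ∫ w, Ang (z - w) (z' - w) ∂ν


namespace Aux

abbrev G2 : Measure (ℝ × ℝ) := (gaussianReal 0 1).prod (gaussianReal 0 1)

lemma stdG_eq (d : ℕ) : _root_.stdGaussian d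
    = ProbabilityTheory.stdGaussian (EuclideanSpace ℝ (Fin d)) := by
  rw [← ProbabilityTheory.map_pi_eq_stdGaussian]; rfl

instance (d : ℕ) : IsProbabilityMeasure (_root_.stdGaussian d) := by
  rw [stdG_eq]; infer_instance

instance (d : ℕ) : IsProbabilityMeasure (sphereUniform d) := by
  unfold sphereUniform
  exact Measure.isProbabilityMeasure_map (by fun_prop)

lemma law_pair {d : ℕ} (u v : EuclideanSpace ℝ (Fin d)) (hu : ‖u‖ = 1) (hv : ‖v‖ = 1)
    (s : ℝ) (hs : s ^ 2 = 1 - ⟪u, v⟫ ^ 2) :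
    (_root_.stdGaussian d).map (fun β => (⟪β, u⟫, ⟪β, v⟫))
      = G2.map (fun p => (p.1, ⟪u, v⟫ * p.1 + s * p.2)) := by
  rw [stdG_eq]
  let T : EuclideanSpace ℝ (Fin d) →L[ℝ] ℝ × ℝ := (innerSL ℝ u).prod (innerSL ℝ v)
  let S : ℝ × ℝ →L[ℝ] ℝ × ℝ := (ContinuousLinearMap.fst ℝ ℝ ℝ).prod
    (⟪u, v⟫ • ContinuousLinearMap.fst ℝ ℝ ℝ + s • ContinuousLinearMap.snd ℝ ℝ ℝ)
  have hT : (fun β => (⟪β, u⟫, ⟪β, v⟫)) = ⇑T := by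
    ext β <;> simp [T, real_inner_comm]
  have hS : (fun p : ℝ × ℝ => (p.1, ⟪u, v⟫ * p.1 + s * p.2)) = ⇑S := by
    ext p <;> simp [S]
  rw [hT, hS]
  have : IsFiniteMeasure ((ProbabilityTheory.stdGaussian (EuclideanSpace ℝ (Fin d))).map ⇑T) := by
    infer_instance
  apply Measure.ext_of_charFunDual
  ext L
  rw [charFunDual_map, charFunDual_map, charFunDual_stdGaussian, charFunDual_prod]
  have h1 : ∀ p : ℝ × ℝ, L p = p.1 * L (1, 0) + p.2 * L (0, 1) := by
    intro p
    have : p = p.1 • ((1:ℝ), (0:ℝ)) + p.2 • ((0:ℝ), (1:ℝ)) := by ext <;> simp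
    conv_lhs => rw [this, map_add, map_smul, map_smul]
    simp only [smul_eq_mul]
  set a := L (1, 0)
  set b := L (0, 1)
  have h2 : L.comp T = innerSL ℝ (a • u + b • v) := by
    ext β
    simp only [ContinuousLinearMap.comp_apply, h1, T]
    simp [inner_add_left, inner_smul_left]
    ring
  have h3 : ‖L.comp T‖ ^ 2 = (a + b * ⟪u, v⟫) ^ 2 + (b * s) ^ 2 := by
    rw [h2, innerSL_apply_norm, ← real_inner_self_eq_norm_sq]
    simp only [inner_add_left, inner_add_right, inner_smul_left, inner_smul_right,
      real_inner_self_eq_norm_sq, hu, hv, real_inner_comm u v]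
    simp
    linear_combination (-b^2) * hs
  have h4 : ∀ (M : ℝ →L[ℝ] ℝ), charFunDual (gaussianReal 0 1) M
      = Complex.exp (-((M 1 : ℝ) : ℂ) ^ 2 / 2) := by
    intro M
    rw [charFunDual_eq_charFun_map_one]
    have : ⇑M = fun x => (M 1) * x := by
      ext x
      have := M.map_smul x 1
      simp at this
      rw [this]; ring
    rw [this, charFun_map_mul, charFun_gaussianReal]
    congr 1
    simp
    ring
  rw [h4, h4, ← Complex.exp_add]
  congr 1
  have h5 : ((L.comp S).comp (ContinuousLinearMap.inl ℝ ℝ ℝ)) 1 = a + b * ⟪u, v⟫ := by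
    simp [h1, S]; ring
  have h6 : ((L.comp S).comp (ContinuousLinearMap.inr ℝ ℝ ℝ)) 1 = b * s := by
    simp [h1, S]; ring
  rw [h5, h6, ← Complex.ofReal_pow, h3]
  push_cast
  ring


/-- radial part of the Gaussian density -/
def radC : ℝ≥0∞ := ∫⁻ r in Set.Ioi (0:ℝ), ENNReal.ofReal (r * ((2 * π)⁻¹ * rexp (-r ^ 2 / 2)))

lemma pdf_mul (x y : ℝ) : gaussianPDF 0 1 x * gaussianPDF 0 1 y
    = ENNReal.ofReal ((2 * π)⁻¹ * rexp (-(x ^ 2 + y ^ 2) / 2)) := by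
  simp only [gaussianPDF]
  rw [← ENNReal.ofReal_mul (gaussianPDFReal_nonneg _ _ _)]
  congr 1
  simp only [gaussianPDFReal]
  have : (√(2 * π * ((1 : NNReal) : ℝ)))⁻¹ * (√(2 * π * ((1 : NNReal) : ℝ)))⁻¹ = (2 * π)⁻¹ := by
    rw [← mul_inv, Real.mul_self_sqrt (by positivity)]; simp
  rw [← this]
  have e : rexp (-(x ^ 2 + y ^ 2) / 2) = rexp (-x ^ 2 / 2) * rexp (-y ^ 2 / 2) := by
    rw [← Real.exp_add]; congr 1; ring
  rw [e]; simp; ring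

lemma cone_measure (A : Set (ℝ × ℝ)) (hA : MeasurableSet A) (B : Set ℝ) (hB : MeasurableSet B)
    (hBs : B ⊆ Set.Ioo (-π) π)
    (h : ∀ r φ : ℝ, 0 < r → φ ∈ Set.Ioo (-π) π → ((r * cos φ, r * sin φ) ∈ A ↔ φ ∈ B)) :
    G2 A = radC * volume B := by
  have hG : G2 = (volume : Measure (ℝ × ℝ)).withDensity
      (fun p => ENNReal.ofReal ((2 * π)⁻¹ * rexp (-(p.1 ^ 2 + p.2 ^ 2) / 2))) := by
    unfold G2
    rw [gaussianReal_of_var_ne_zero _ one_ne_zero, prod_withDensity (by fun_prop) (by fun_prop)]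
    rw [Measure.volume_eq_prod]
    congr 1
    ext p
    exact pdf_mul _ _
  rw [hG, withDensity_apply _ hA, ← lintegral_indicator hA, ← lintegral_comp_polarCoord_symm,
    polarCoord_target]
  have hmeas : MeasurableSet (Set.Ioi (0:ℝ) ×ˢ Set.Ioo (-π) π) := by measurability
  rw [setLIntegral_congr_fun (g := fun p : ℝ × ℝ =>
    ENNReal.ofReal (p.1 * ((2 * π)⁻¹ * rexp (-p.1 ^ 2 / 2))) * B.indicator 1 p.2) hmeas]
  · rw [Measure.volume_eq_prod, ← Measure.prod_restrict, lintegral_prod_mul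
      (f := fun r : ℝ => ENNReal.ofReal (r * ((2 * π)⁻¹ * rexp (-r ^ 2 / 2))))
      (g := B.indicator 1) (by fun_prop)]
    · rw [lintegral_indicator_one hB, Measure.restrict_apply hB, Set.inter_eq_left.mpr hBs]
      rfl
    · exact (measurable_one.indicator hB).aemeasurable
  · rintro ⟨r, φ⟩ ⟨hr, hφ⟩
    simp only [Set.mem_Ioi] at hr
    simp only [polarCoord_symm_apply, smul_eq_mul]
    by_cases hb : φ ∈ B
    · rw [Set.indicator_of_mem ((h r φ hr hφ).2 hb), Set.indicator_of_mem hb,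
        ← ENNReal.ofReal_mul hr.le]
      have : (r * cos φ) ^ 2 + (r * sin φ) ^ 2 = r ^ 2 := by
        linear_combination r ^ 2 * Real.cos_sq_add_sin_sq φ
      simp [this]
    · rw [Set.indicator_of_notMem (fun hh => hb ((h r φ hr hφ).1 hh)),
        Set.indicator_of_notMem hb]
      simp

/-- The Gaussian measure of a wedge. -/
lemma wedge (θ : ℝ) (h0 : 0 ≤ θ) (h1 : θ ≤ π) :
    G2 {p | 0 < p.1 ∧ cos θ * p.1 + sin θ * p.2 ≤ 0} = ENNReal.ofReal (θ / (2 * π)) := by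
  have hm : MeasurableSet {p : ℝ × ℝ | 0 < p.1 ∧ cos θ * p.1 + sin θ * p.2 ≤ 0} := by
    apply MeasurableSet.inter
    · exact measurableSet_lt measurable_const measurable_fst
    · exact measurableSet_le (f := fun p : ℝ × ℝ => cos θ * p.1 + sin θ * p.2)
        (by fun_prop) measurable_const
  have hpi := Real.pi_pos
  have hu := cone_measure Set.univ MeasurableSet.univ (Set.Ioo (-π) π) measurableSet_Ioo
    subset_rfl (fun r φ _ hφ => by simpa using hφ)
  rw [measure_univ, Real.volume_Ioo] at hu
  have hC : radC = ENNReal.ofReal (1 / (2 * π)) := by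
    rw [one_div, ENNReal.ofReal_inv_of_pos (by positivity)]
    refine ENNReal.eq_inv_of_mul_eq_one_left ?_
    rw [hu]; congr 2; ring
  have hV : volume (Set.Ioc (-(π / 2)) (θ - π / 2) ∩ Set.Iio (π / 2)) = ENNReal.ofReal θ := by
    apply le_antisymm
    · refine (measure_mono Set.inter_subset_left).trans ?_
      rw [Real.volume_Ioc]; apply le_of_eq; congr 1; ring
    · have : Set.Ioo (-(π / 2)) (θ - π / 2) ⊆ Set.Ioc (-(π / 2)) (θ - π / 2) ∩ Set.Iio (π / 2) :=
        fun x hx => ⟨⟨hx.1, hx.2.le⟩, by have := hx.2; simp only [Set.mem_Iio]; linarith⟩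
      refine le_trans ?_ (measure_mono this)
      rw [Real.volume_Ioo]; apply le_of_eq; congr 1; ring
  rw [cone_measure _ hm (Set.Ioc (-(π / 2)) (θ - π / 2) ∩ Set.Iio (π / 2))
    (measurableSet_Ioc.inter measurableSet_Iio), hC, hV, ← ENNReal.ofReal_mul (by positivity)]
  · congr 1; ring
  · rintro x ⟨hx, hx'⟩
    simp only [Set.mem_Iio] at hx'
    exact ⟨by linarith [hx.1], by linarith [hx.2]⟩
  · intro r φ hr hφ
    have e : cos θ * (r * cos φ) + sin θ * (r * sin φ) = r * cos (φ - θ) := by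
      rw [Real.cos_sub]; ring
    simp only [Set.mem_ofPred_eq, e, Set.mem_inter_iff, Set.mem_Iio, Set.mem_Ioc, mul_pos_iff_of_pos_left hr]
    have hcos : 0 < cos φ ↔ (-(π/2) < φ ∧ φ < π / 2) := by
      constructor
      · intro hc
        by_contra hcon
        rw [not_and_or, not_lt, not_lt] at hcon
        rcases hcon with hcon | hcon
        · have := Real.cos_nonpos_of_pi_div_two_le_of_le (x := -φ) (by linarith)
            (by linarith [hφ.1])
          rw [Real.cos_neg] at this; linarith
        · have := Real.cos_nonpos_of_pi_div_two_le_of_le hcon (by linarith [hφ.2])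
          linarith
      · rintro ⟨ha, hb⟩
        exact Real.cos_pos_of_mem_Ioo ⟨ha, hb⟩
    rw [hcos]
    constructor
    · rintro ⟨⟨ha, hb⟩, hc⟩
      refine ⟨⟨ha, ?_⟩, hb⟩
      by_contra hcon
      have := Real.cos_pos_of_mem_Ioo (x := φ - θ) ⟨by linarith, by linarith⟩
      nlinarith
    · rintro ⟨⟨ha, hb⟩, hb'⟩
      refine ⟨⟨ha, hb'⟩, ?_⟩
      have := Real.cos_nonpos_of_pi_div_two_le_of_le (x := -(φ - θ)) (by linarith)
            (by linarith [hφ.1])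
      rw [Real.cos_neg] at this
      nlinarith

lemma gauss_wedge {d : ℕ} (u v : EuclideanSpace ℝ (Fin d)) (hu : u ≠ 0) (hv : v ≠ 0) :
    _root_.stdGaussian d {β | 0 < ⟪β, u⟫ ∧ ⟪β, v⟫ ≤ 0} = ENNReal.ofReal (Ang u v / (2 * π)) := by
  have hu' : 0 < ‖u‖ := norm_pos_iff.2 hu
  have hv' : 0 < ‖v‖ := norm_pos_iff.2 hv
  set u1 := ‖u‖⁻¹ • u with hu1
  set v1 := ‖v‖⁻¹ • v with hv1
  have nu : ‖u1‖ = 1 := norm_smul_inv_norm (𝕜 := ℝ) hu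
  have nv : ‖v1‖ = 1 := norm_smul_inv_norm (𝕜 := ℝ) hv
  have hin : ⟪u, v⟫ / (‖u‖ * ‖v‖) = ⟪u1, v1⟫ := by
    rw [hu1, hv1, real_inner_smul_left, real_inner_smul_right]
    field_simp
  have habs : |⟪u1, v1⟫| ≤ 1 := by
    have := abs_real_inner_le_norm u1 v1
    rwa [nu, nv, one_mul] at this
  have hc : cos (Ang u v) = ⟪u1, v1⟫ := by
    unfold Ang
    rw [hin, Real.cos_arccos (abs_le.1 habs).1 (abs_le.1 habs).2]
  rw [← wedge (Ang u v) (Real.arccos_nonneg _) (Real.arccos_le_pi _)]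
  have hset : {β : EuclideanSpace ℝ (Fin d) | 0 < ⟪β, u⟫ ∧ ⟪β, v⟫ ≤ 0}
      = (fun β => (⟪β, u1⟫, ⟪β, v1⟫)) ⁻¹' {p : ℝ × ℝ | 0 < p.1 ∧ p.2 ≤ 0} := by
    ext β
    simp only [Set.mem_ofPred_eq, Set.mem_preimage, hu1, hv1, real_inner_smul_right]
    rw [mul_pos_iff_of_pos_left (inv_pos.2 hu'), mul_nonpos_iff_pos_imp_nonpos]
    have := inv_pos.2 hv'
    constructor
    · rintro ⟨a, b⟩; exact ⟨a, fun _ => b, fun _ => this.le⟩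
    · rintro ⟨a, b, _⟩; exact ⟨a, b this⟩
  have hm : MeasurableSet {p : ℝ × ℝ | 0 < p.1 ∧ p.2 ≤ 0} :=
    (measurableSet_lt measurable_const measurable_fst).inter
      (measurableSet_le measurable_snd measurable_const)
  rw [hset, ← Measure.map_apply (by fun_prop) hm, law_pair u1 v1 nu nv (sin (Ang u v)),
    Measure.map_apply (by fun_prop) hm, hc]
  · rfl
  · rw [Real.sin_sq, hc]

lemma sphere_apply {d : ℕ} (u v : EuclideanSpace ℝ (Fin d)) (hu : u ≠ 0) (hv : v ≠ 0) :
    sphereUniform d {β | 0 < ⟪β, u⟫ ∧ ⟪β, v⟫ ≤ 0} = ENNReal.ofReal (Ang u v / (2 * π)) := by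
  rw [← gauss_wedge u v hu hv]
  unfold sphereUniform
  rw [Measure.map_apply (by fun_prop)]
  · congr 1
    ext β
    simp only [Set.mem_ofPred_eq, Set.mem_preimage, real_inner_smul_left]
    rcases eq_or_ne β 0 with rfl | hβ
    · simp
    · have := inv_pos.2 (norm_pos_iff.2 hβ)
      rw [mul_pos_iff_of_pos_left this, mul_nonpos_iff_pos_imp_nonpos]
      constructor
      · rintro ⟨a, b, _⟩; exact ⟨a, b this⟩
      · rintro ⟨a, b⟩; exact ⟨a, fun _ => b, fun _ => this.le⟩
  · exact (measurableSet_lt measurable_const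
      (by fun_prop : Measurable fun β : EuclideanSpace ℝ (Fin d) => ⟪β, u⟫)).inter
      (measurableSet_le (by fun_prop : Measurable fun β : EuclideanSpace ℝ (Fin d) => ⟪β, v⟫)
        measurable_const)

lemma Ang_comm {d : ℕ} (u v : EuclideanSpace ℝ (Fin d)) : Ang u v = Ang v u := by
  unfold Ang; rw [real_inner_comm, mul_comm]

/-! one-dimensional part -/

def ii (x z : ℝ) : ℝ := if x ≤ z then 1 else 0

lemma ii_meas : Measurable fun p : ℝ × ℝ => ii p.1 p.2 := by
  unfold ii
  exact Measurable.ite (measurableSet_le measurable_fst measurable_snd) measurable_const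
    measurable_const

lemma ii_bd (x z : ℝ) : ‖ii x z‖ ≤ 1 := by
  unfold ii; split_ifs <;> simp

lemma ii_int (a : Measure ℝ) [IsProbabilityMeasure a] (z : ℝ) : ∫ x, ii x z ∂a = a.real (Set.Iic z) := by
  have : (fun x => ii x z) = (Set.Iic z).indicator 1 := by
    ext x; simp [ii, Set.indicator]
  rw [this, integral_indicator_one measurableSet_Iic]

def tri (p : ℝ × ℝ × ℝ) : ℝ := ii p.2.1 p.1 * ii p.2.2 p.1

lemma tri_meas : Measurable tri := by
  unfold tri
  exact (ii_meas.comp (by fun_prop : Measurable fun p : ℝ × ℝ × ℝ => (p.2.1, p.1))).mul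
    (ii_meas.comp (by fun_prop : Measurable fun p : ℝ × ℝ × ℝ => (p.2.2, p.1)))

lemma tri_bd (p : ℝ × ℝ × ℝ) : ‖tri p‖ ≤ 1 := by
  unfold tri; rw [norm_mul]
  exact mul_le_one₀ (ii_bd _ _) (norm_nonneg _) (ii_bd _ _)

lemma tri_int (a b c : Measure ℝ) [IsProbabilityMeasure a] [IsProbabilityMeasure b]
    [IsProbabilityMeasure c] :
    ∫ p, tri p ∂(a.prod (b.prod c)) = ∫ x, b.real (Set.Iic x) * c.real (Set.Iic x) ∂a := by
  rw [integral_prod _ (Integrable.of_bound tri_meas.aestronglyMeasurable 1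
    (Filter.Eventually.of_forall tri_bd))]
  congr 1
  ext x
  simp only [tri]
  rw [integral_prod_mul (fun y => ii y x) (fun z => ii z x), ii_int, ii_int]

def rot (p : ℝ × ℝ × ℝ) : ℝ × ℝ × ℝ := (p.2.1, p.2.2, p.1)

lemma rot_mp (a b c : Measure ℝ) [IsProbabilityMeasure a] [IsProbabilityMeasure b]
    [IsProbabilityMeasure c] :
    MeasurePreserving rot (a.prod (b.prod c)) (b.prod (c.prod a)) :=
  (measurePreserving_prodAssoc b c a).comp (Measure.measurePreserving_swap (μ := a) (ν := b.prod c))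

lemma tie (a : Measure ℝ) [IsProbabilityMeasure a] {Y : Type*} [MeasurableSpace Y]
    (m : Measure Y) [IsProbabilityMeasure m] (f : Y → ℝ) (hf : Measurable f)
    (h : ∀ t, m {y | f y = t} = 0) : ∀ᵐ p ∂(a.prod m), p.1 ≠ f p.2 := by
  rw [ae_iff]
  have hm : MeasurableSet {p : ℝ × Y | ¬ (p.1 ≠ f p.2)} := by
    simp only [ne_eq, not_not]
    exact measurableSet_eq_fun measurable_fst (hf.comp measurable_snd)
  rw [Measure.measure_prod_null hm]
  refine Filter.Eventually.of_forall fun x => ?_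
  have hx := h x
  have e : Prod.mk x ⁻¹' {p : ℝ × Y | ¬ (p.1 ≠ f p.2)} = {y | f y = x} := by
    ext y
    simp [eq_comm]
  simp only [e, hx, Pi.zero_apply]

lemma three (a b c : Measure ℝ) [IsProbabilityMeasure a] [IsProbabilityMeasure b]
    [IsProbabilityMeasure c] (hb : ∀ t, b {t} = 0) (hc : ∀ t, c {t} = 0) :
    ∫ x, b.real (Set.Iic x) * c.real (Set.Iic x) ∂a
      + ∫ x, c.real (Set.Iic x) * a.real (Set.Iic x) ∂b
      + ∫ x, a.real (Set.Iic x) * b.real (Set.Iic x) ∂c = 1 := by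
  have hr : Measurable rot := (rot_mp a b c).measurable
  rw [← tri_int, ← tri_int, ← tri_int, ← (rot_mp a b c).map_eq, ← (rot_mp b c a).map_eq,
    ← (rot_mp a b c).map_eq,
    integral_map hr.aemeasurable tri_meas.aestronglyMeasurable,
    integral_map hr.aemeasurable tri_meas.aestronglyMeasurable,
    integral_map (f := fun p => tri (rot p)) hr.aemeasurable (tri_meas.comp hr).aestronglyMeasurable]
  have hi1 : Integrable tri (a.prod (b.prod c)) := Integrable.of_bound
    tri_meas.aestronglyMeasurable 1 (Filter.Eventually.of_forall tri_bd)
  have hi2 : Integrable (fun p => tri (rot p)) (a.prod (b.prod c)) := Integrable.of_bound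
    (tri_meas.comp hr).aestronglyMeasurable 1 (Filter.Eventually.of_forall fun p => tri_bd _)
  have hi3 : Integrable (fun p => tri (rot (rot p))) (a.prod (b.prod c)) := Integrable.of_bound
    ((tri_meas.comp hr).comp hr).aestronglyMeasurable 1
    (Filter.Eventually.of_forall fun p => tri_bd _)
  rw [← integral_add hi1 hi2, ← integral_add (hi1.fun_add hi2) hi3]
  have t1 : ∀ᵐ p ∂(a.prod (b.prod c)), p.1 ≠ p.2.1 := by
    apply tie a (b.prod c) Prod.fst measurable_fst
    intro t
    have : {y : ℝ × ℝ | y.1 = t} = {t} ×ˢ Set.univ := by ext; simp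
    rw [this, Measure.prod_prod, hb, zero_mul]
  have t2 : ∀ᵐ p ∂(a.prod (b.prod c)), p.1 ≠ p.2.2 := by
    apply tie a (b.prod c) Prod.snd measurable_snd
    intro t
    have : {y : ℝ × ℝ | y.2 = t} = Set.univ ×ˢ {t} := by ext; simp
    rw [this, Measure.prod_prod, hc, mul_zero]
  have t3 : ∀ᵐ p ∂(a.prod (b.prod c)), p.2.1 ≠ p.2.2 := by
    have := tie b c id measurable_id (fun t => by simpa using hc t)
    exact Measure.quasiMeasurePreserving_snd.ae this
  have : ∀ᵐ p ∂(a.prod (b.prod c)), tri p + tri (rot p) + tri (rot (rot p)) = 1 := by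
    filter_upwards [t1, t2, t3] with p h1 h2 h3
    simp only [tri, rot, ii]
    rcases lt_or_gt_of_ne h1 with h1 | h1 <;> rcases lt_or_gt_of_ne h2 with h2 | h2 <;>
    rcases lt_or_gt_of_ne h3 with h3 | h3 <;> first | (exfalso; linarith) | skip
    all_goals simp [h1.le, h2.le, h3.le, h1.not_ge, h2.not_ge, h3.not_ge]
  rw [integral_congr_ae this]
  simp

lemma cdf_int (m a b : Measure ℝ) [IsProbabilityMeasure m] [IsProbabilityMeasure a]
    [IsProbabilityMeasure b] :
    Integrable (fun x => a.real (Set.Iic x) * b.real (Set.Iic x)) m := by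
  have mm : ∀ a : Measure ℝ, IsProbabilityMeasure a → Measurable fun x => a.real (Set.Iic x) :=
    fun a _ => Monotone.measurable fun x y h => measureReal_mono (Set.Iic_subset_Iic.2 h)
  refine Integrable.of_bound ((mm a ‹_›).mul (mm b ‹_›)).aestronglyMeasurable 1
    (Filter.Eventually.of_forall fun x => ?_)
  rw [Real.norm_of_nonneg (by positivity)]
  exact mul_le_one₀ measureReal_le_one (by positivity) measureReal_le_one

lemma sq_exp (m a b : Measure ℝ) [IsProbabilityMeasure m] [IsProbabilityMeasure a]
    [IsProbabilityMeasure b] :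
    ∫ x, (a.real (Set.Iic x) - b.real (Set.Iic x)) ^ 2 ∂m
      = ∫ x, a.real (Set.Iic x) * a.real (Set.Iic x) ∂m
        - 2 * ∫ x, a.real (Set.Iic x) * b.real (Set.Iic x) ∂m
        + ∫ x, b.real (Set.Iic x) * b.real (Set.Iic x) ∂m := by
  rw [← integral_const_mul, ← integral_sub (cdf_int m a a) ((cdf_int m a b).const_mul 2),
    ← integral_add ((cdf_int m a a).sub' ((cdf_int m a b).const_mul 2)) (cdf_int m b b)]
  congr 1; ext x; ring

lemma oneD (a b : Measure ℝ) [IsProbabilityMeasure a]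
    [IsProbabilityMeasure b] (ha : ∀ t, a {t} = 0) (hb : ∀ t, b {t} = 0) :
    ∫ x, (a.real (Set.Iic x) - b.real (Set.Iic x)) ^ 2 ∂a
      = ∫ x, (a.real (Set.Iic x) - b.real (Set.Iic x)) ^ 2 ∂b := by
  rw [sq_exp, sq_exp]
  have h1 := three a a a ha ha
  have h2 := three a a b ha hb
  have h3 := three a b b hb hb
  have h4 := three b b b hb hb
  have e : ∀ m : Measure ℝ, ∫ x, b.real (Set.Iic x) * a.real (Set.Iic x) ∂m
      = ∫ x, a.real (Set.Iic x) * b.real (Set.Iic x) ∂m := by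
    intro m; congr 1; ext x; ring
  rw [e] at h2 h3
  linarith

/-! assembly -/

variable {d : ℕ}

lemma projLaw_prob (P : Measure (EuclideanSpace ℝ (Fin d))) [IsProbabilityMeasure P]
    (β : EuclideanSpace ℝ (Fin d)) : IsProbabilityMeasure (projLaw P β) :=
  Measure.isProbabilityMeasure_map (by fun_prop)

lemma projCDF_eq (P : Measure (EuclideanSpace ℝ (Fin d)))
    (β : EuclideanSpace ℝ (Fin d)) (t : ℝ) : projCDF P β t = (projLaw P β).real (Set.Iic t) := by
  unfold projCDF projLaw Measure.real
  rw [Measure.map_apply (by fun_prop) measurableSet_Iic]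
  rfl

lemma mix (P Q : Measure (EuclideanSpace ℝ (Fin d))) [IsProbabilityMeasure P]
    [IsProbabilityMeasure Q] (β : EuclideanSpace ℝ (Fin d)) (hP : ∀ t : ℝ, projLaw P β {t} = 0)
    (hQ : ∀ t : ℝ, projLaw Q β {t} = 0) (c₁ c₂ : ℝ≥0∞) (h1 : c₁ ≠ ⊤) (h2 : c₂ ≠ ⊤)
    (h : c₁.toReal + c₂.toReal = 1) :
    ∫ t, (projCDF P β t - projCDF Q β t) ^ 2 ∂(projLaw (c₁ • P + c₂ • Q) β)
      = ∫ t, (projCDF P β t - projCDF Q β t) ^ 2 ∂(projLaw P β) := by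
  have hp := projLaw_prob P β
  have hq := projLaw_prob Q β
  have e : projLaw (c₁ • P + c₂ • Q) β = c₁ • projLaw P β + c₂ • projLaw Q β := by
    unfold projLaw
    rw [Measure.map_add _ _ (by fun_prop), Measure.map_smul, Measure.map_smul]
  simp only [projCDF_eq]
  have hi : ∀ m : Measure ℝ, IsProbabilityMeasure m → Integrable (fun x =>
      ((projLaw P β).real (Set.Iic x) - (projLaw Q β).real (Set.Iic x)) ^ 2) m := by
    intro m _
    have := (((cdf_int m (projLaw P β) (projLaw P β)).sub
      ((cdf_int m (projLaw P β) (projLaw Q β)).const_mul 2))).add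
      (cdf_int m (projLaw Q β) (projLaw Q β))
    refine this.congr (Filter.Eventually.of_forall fun x => ?_)
    simp only [Pi.add_apply, Pi.sub_apply]
    ring
  rw [e, integral_add_measure ((hi _ hp).smul_measure h1) ((hi _ hq).smul_measure h2),
    integral_smul_measure, integral_smul_measure, ← oneD _ _ hP hQ, ← add_smul, h, one_smul]

def I0 (β w x : EuclideanSpace ℝ (Fin d)) : ℝ := if ⟪β, x⟫ ≤ ⟪β, w⟫ then 1 else 0

def K0 (β w x y : EuclideanSpace ℝ (Fin d)) : ℝ :=
  I0 β w x + I0 β w y - 2 * (I0 β w x * I0 β w y)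

lemma I0_meas : Measurable fun p : EuclideanSpace ℝ (Fin d) × EuclideanSpace ℝ (Fin d) ×
    EuclideanSpace ℝ (Fin d) => I0 p.1 p.2.1 p.2.2 := by
  unfold I0
  exact Measurable.ite (measurableSet_le
    (by fun_prop : Measurable fun p : EuclideanSpace ℝ (Fin d) × EuclideanSpace ℝ (Fin d) ×
      EuclideanSpace ℝ (Fin d) => ⟪p.1, p.2.2⟫)
    (by fun_prop : Measurable fun p : EuclideanSpace ℝ (Fin d) × EuclideanSpace ℝ (Fin d) ×
      EuclideanSpace ℝ (Fin d) => ⟪p.1, p.2.1⟫)) measurable_const measurable_const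

lemma K0_meas {α : Type*} [MeasurableSpace α] {f g h k : α → EuclideanSpace ℝ (Fin d)}
    (hf : Measurable f) (hg : Measurable g) (hh : Measurable h) (hk : Measurable k) :
    Measurable fun t => K0 (f t) (g t) (h t) (k t) := by
  have h1 := I0_meas.comp (hf.prodMk (hg.prodMk hh))
  have h2 := I0_meas.comp (hf.prodMk (hg.prodMk hk))
  exact (h1.add h2).sub ((h1.mul h2).const_mul 2)

lemma K0_bd (β w x y : EuclideanSpace ℝ (Fin d)) : ‖K0 β w x y‖ ≤ 1 := by
  unfold K0 I0
  split_ifs <;> norm_num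

lemma I0_bd (β w x : EuclideanSpace ℝ (Fin d)) : ‖I0 β w x‖ ≤ 1 := by
  unfold I0
  split_ifs <;> norm_num

lemma I0_int (a : Measure (EuclideanSpace ℝ (Fin d))) (β w : EuclideanSpace ℝ (Fin d)) :
    ∫ x, I0 β w x ∂a = projCDF a β ⟪β, w⟫ := by
  have : (fun x => I0 β w x) = ({x | ⟪β, x⟫ ≤ ⟪β, w⟫} : Set _).indicator 1 := by
    ext x; simp [I0, Set.indicator]
  rw [this, integral_indicator_one]
  · rfl
  · exact measurableSet_le (by fun_prop : Measurable fun x : EuclideanSpace ℝ (Fin d) => ⟪β, x⟫)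
      measurable_const

lemma I0_integrable (a : Measure (EuclideanSpace ℝ (Fin d))) [IsProbabilityMeasure a]
    (β w : EuclideanSpace ℝ (Fin d)) : Integrable (fun x => I0 β w x) a :=
  Integrable.of_bound (I0_meas.comp (by fun_prop : Measurable
    fun x : EuclideanSpace ℝ (Fin d) => (β, w, x))).aestronglyMeasurable 1
    (Filter.Eventually.of_forall fun x => I0_bd _ _ _)

lemma K0_int (a b : Measure (EuclideanSpace ℝ (Fin d))) [IsProbabilityMeasure a]
    [IsProbabilityMeasure b] (β w : EuclideanSpace ℝ (Fin d)) :
    ∫ p, K0 β w p.1 p.2 ∂(a.prod b) = projCDF a β ⟪β, w⟫ + projCDF b β ⟪β, w⟫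
      - 2 * (projCDF a β ⟪β, w⟫ * projCDF b β ⟪β, w⟫) := by
  unfold K0
  have h1 := (I0_integrable a β w).comp_fst b
  have h2 := (I0_integrable b β w).comp_snd a
  have h3 := (I0_integrable a β w).mul_prod (I0_integrable b β w)
  rw [integral_sub (h1.fun_add h2) (h3.const_mul 2), integral_add h1 h2, integral_const_mul,
    integral_prod_mul (fun x => I0 β w x) (fun x => I0 β w x),
    integral_fun_fst (fun x => I0 β w x), integral_fun_snd (fun x => I0 β w x)]
  simp [I0_int]

lemma K0_sphere (w x y : EuclideanSpace ℝ (Fin d)) (hx : x ≠ w) (hy : y ≠ w) :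
    ∫ β, K0 β w x y ∂(sphereUniform d) = 1 / π * Ang (x - w) (y - w) := by
  have hm : ∀ u v : EuclideanSpace ℝ (Fin d), MeasurableSet
      {β : EuclideanSpace ℝ (Fin d) | 0 < ⟪β, u⟫ ∧ ⟪β, v⟫ ≤ 0} := fun u v =>
    (measurableSet_lt measurable_const
      (by fun_prop : Measurable fun β : EuclideanSpace ℝ (Fin d) => ⟪β, u⟫)).inter
      (measurableSet_le (by fun_prop : Measurable fun β : EuclideanSpace ℝ (Fin d) => ⟪β, v⟫)
        measurable_const)
  have e : (fun β => K0 β w x y) = fun β =>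
      Set.indicator {β | 0 < ⟪β, x - w⟫ ∧ ⟪β, y - w⟫ ≤ 0} (1 : EuclideanSpace ℝ (Fin d) → ℝ) β
      + Set.indicator {β | 0 < ⟪β, y - w⟫ ∧ ⟪β, x - w⟫ ≤ 0} (1 : EuclideanSpace ℝ (Fin d) → ℝ) β := by
    ext β
    simp only [K0, I0, Set.indicator, Set.mem_ofPred_eq, inner_sub_right, sub_pos, sub_nonpos,
      Pi.one_apply]
    by_cases h1 : ⟪β, x⟫ ≤ ⟪β, w⟫ <;> by_cases h2 : ⟪β, y⟫ ≤ ⟪β, w⟫ <;>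
      simp [h1, h2, not_lt.2, not_le.1] <;> norm_num
  have hi : ∀ s : Set (EuclideanSpace ℝ (Fin d)), MeasurableSet s →
      Integrable (s.indicator (1 : EuclideanSpace ℝ (Fin d) → ℝ)) (sphereUniform d) := fun s hs =>
    (integrable_const (1:ℝ)).indicator hs
  rw [e, integral_add (hi _ (hm _ _)) (hi _ (hm _ _)), integral_indicator_one (hm _ _),
    integral_indicator_one (hm _ _)]
  unfold Measure.real
  have hx' := sub_ne_zero.2 hx
  have hy' := sub_ne_zero.2 hy
  have hA : 0 ≤ Ang (x - w) (y - w) := Real.arccos_nonneg _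
  rw [sphere_apply _ _ hx' hy', sphere_apply _ _ hy' hx', Ang_comm (y - w),
    ENNReal.toReal_ofReal (by positivity)]
  field_simp
  norm_num

lemma no_atom (P : Measure (EuclideanSpace ℝ (Fin d))) 
    (h : ∀ᵐ β ∂(sphereUniform d), ∀ t : ℝ, projLaw P β {t} = 0) (x : EuclideanSpace ℝ (Fin d)) :
    P {x} = 0 := by
  obtain ⟨β, hβ⟩ := h.exists
  refine measure_mono_null ?_ (by
    have := hβ ⟪β, x⟫
    unfold projLaw at this
    rwa [Measure.map_apply (by fun_prop) (measurableSet_singleton _)] at this)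
  simp

lemma angDist_eq (N : Measure (EuclideanSpace ℝ (Fin d))) [IsProbabilityMeasure N]
    (hN : ∀ x, N {x} = 0) (x y : EuclideanSpace ℝ (Fin d)) :
    angDist N x y = ∫ q, K0 q.1 q.2 x y ∂((sphereUniform d).prod N) := by
  rw [integral_prod_symm]
  · unfold angDist
    rw [← integral_const_mul]
    apply integral_congr_ae
    have h1 : ∀ x, ∀ᵐ w ∂N, x ≠ w := by
      intro x
      rw [ae_iff]
      convert hN x using 2
      ext w; simp [eq_comm]
    filter_upwards [h1 x, h1 y] with w hx hy
    exact (K0_sphere w x y hx hy).symm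
  · exact Integrable.of_bound (K0_meas measurable_fst measurable_snd measurable_const
      measurable_const).aestronglyMeasurable 1 (Filter.Eventually.of_forall fun x => K0_bd _ _ _ _)

lemma angDist_int (N : Measure (EuclideanSpace ℝ (Fin d))) [IsProbabilityMeasure N]
    (hN : ∀ x, N {x} = 0) (a b : Measure (EuclideanSpace ℝ (Fin d))) [IsProbabilityMeasure a]
    [IsProbabilityMeasure b] :
    ∫ x, ∫ y, angDist N x y ∂b ∂a = ∫ q, (projCDF a q.1 ⟪q.1, q.2⟫ + projCDF b q.1 ⟪q.1, q.2⟫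
      - 2 * (projCDF a q.1 ⟪q.1, q.2⟫ * projCDF b q.1 ⟪q.1, q.2⟫))
        ∂((sphereUniform d).prod N) := by
  have hi : Integrable (fun z : (EuclideanSpace ℝ (Fin d) × EuclideanSpace ℝ (Fin d)) ×
      (EuclideanSpace ℝ (Fin d) × EuclideanSpace ℝ (Fin d)) => K0 z.2.1 z.2.2 z.1.1 z.1.2)
      ((a.prod b).prod ((sphereUniform d).prod N)) :=
    Integrable.of_bound (K0_meas (by fun_prop) (by fun_prop) (by fun_prop)
      (by fun_prop)).aestronglyMeasurable 1 (Filter.Eventually.of_forall fun x => K0_bd _ _ _ _)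
  simp only [angDist_eq N hN]
  rw [← integral_prod (fun p : EuclideanSpace ℝ (Fin d) × EuclideanSpace ℝ (Fin d) =>
    ∫ q, K0 q.1 q.2 p.1 p.2 ∂((sphereUniform d).prod N)) hi.integral_prod_left]
  rw [integral_integral_swap hi]
  simp only [K0_int]

lemma cdf_meas (a : Measure (EuclideanSpace ℝ (Fin d))) [IsProbabilityMeasure a] :
    Measurable fun q : EuclideanSpace ℝ (Fin d) × EuclideanSpace ℝ (Fin d) =>
      projCDF a q.1 ⟪q.1, q.2⟫ := by
  unfold projCDF
  apply Measurable.ennreal_toReal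
  have hs : MeasurableSet {z : (EuclideanSpace ℝ (Fin d) × EuclideanSpace ℝ (Fin d)) ×
      EuclideanSpace ℝ (Fin d) | ⟪z.1.1, z.2⟫ ≤ ⟪z.1.1, z.1.2⟫} :=
    measurableSet_le (by fun_prop : Measurable fun z : (EuclideanSpace ℝ (Fin d) ×
      EuclideanSpace ℝ (Fin d)) × EuclideanSpace ℝ (Fin d) => ⟪z.1.1, z.2⟫)
      (by fun_prop : Measurable fun z : (EuclideanSpace ℝ (Fin d) ×
      EuclideanSpace ℝ (Fin d)) × EuclideanSpace ℝ (Fin d) => ⟪z.1.1, z.1.2⟫)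
  exact measurable_measure_prodMk_left hs

lemma cdf_nonneg (a : Measure (EuclideanSpace ℝ (Fin d)))
    (β : EuclideanSpace ℝ (Fin d)) (t : ℝ) : 0 ≤ projCDF a β t := ENNReal.toReal_nonneg

lemma cdf_le (a : Measure (EuclideanSpace ℝ (Fin d))) [IsProbabilityMeasure a]
    (β : EuclideanSpace ℝ (Fin d)) (t : ℝ) : projCDF a β t ≤ 1 := measureReal_le_one

lemma main (P Q : Measure (EuclideanSpace ℝ (Fin d)))
    [IsProbabilityMeasure P] [IsProbabilityMeasure Q]
    (hc : ContinuityAssumption P Q) (ϑ : ℝ) (hϑ : ϑ ∈ Set.Ioo (0 : ℝ) 1) :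
    2 * cvmSq ϑ P Q
      = 2 * (∫ x, ∫ y, angDist ((2 : ℝ≥0∞)⁻¹ • P + (2 : ℝ≥0∞)⁻¹ • Q) x y ∂Q ∂P)
        - (∫ x1, ∫ x2, angDist ((2 : ℝ≥0∞)⁻¹ • P + (2 : ℝ≥0∞)⁻¹ • Q) x1 x2 ∂P ∂P)
        - (∫ y1, ∫ y2, angDist ((2 : ℝ≥0∞)⁻¹ • P + (2 : ℝ≥0∞)⁻¹ • Q) y1 y2 ∂Q ∂Q) := by
  set N := (2 : ℝ≥0∞)⁻¹ • P + (2 : ℝ≥0∞)⁻¹ • Q with hNdef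
  have hNp : IsProbabilityMeasure N := ⟨by simp [hNdef, ENNReal.inv_two_add_inv_two]⟩
  have hN : ∀ x, N {x} = 0 := by
    intro x
    have h1 := no_atom P (hc.mono fun β h => h.1) x
    have h2 := no_atom Q (hc.mono fun β h => h.2) x
    simp [hNdef, h1, h2]
  have hm : Measurable fun q : EuclideanSpace ℝ (Fin d) × EuclideanSpace ℝ (Fin d) =>
      (projCDF P q.1 ⟪q.1, q.2⟫ - projCDF Q q.1 ⟪q.1, q.2⟫) ^ 2 :=
    ((cdf_meas P).sub (cdf_meas Q)).pow_const 2
  have hW : cvmSq ϑ P Q = ∫ q, (projCDF P q.1 ⟪q.1, q.2⟫ - projCDF Q q.1 ⟪q.1, q.2⟫) ^ 2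
      ∂((sphereUniform d).prod N) := by
    rw [integral_prod]
    · unfold cvmSq
      apply integral_congr_ae
      filter_upwards [hc] with β hβ
      rw [mix P Q β hβ.1 hβ.2 _ _ ENNReal.ofReal_ne_top ENNReal.ofReal_ne_top
        (by rw [ENNReal.toReal_ofReal hϑ.1.le, ENNReal.toReal_ofReal (by linarith [hϑ.2])]; ring),
        ← mix P Q β hβ.1 hβ.2 (2⁻¹) (2⁻¹) (by simp) (by simp) (by simp; norm_num)]
      have hmm : ∀ a : Measure (EuclideanSpace ℝ (Fin d)), IsProbabilityMeasure a →
          Measurable fun t => projCDF a β t := fun a _ => Monotone.measurable fun s t hst => by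
        have := projLaw_prob a β
        rw [projCDF_eq, projCDF_eq]
        exact measureReal_mono (Set.Iic_subset_Iic.2 hst)
      unfold projLaw
      rw [integral_map (by fun_prop)]
      exact (((hmm P ‹_›).sub (hmm Q ‹_›)).pow_const 2).aestronglyMeasurable
    · refine Integrable.of_bound hm.aestronglyMeasurable 1 (Filter.Eventually.of_forall fun q => ?_)
      rw [Real.norm_of_nonneg (sq_nonneg _)]
      have h1 := cdf_nonneg P q.1 ⟪q.1, q.2⟫
      have h2 := cdf_nonneg Q q.1 ⟪q.1, q.2⟫
      have h3 := cdf_le P q.1 ⟪q.1, q.2⟫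
      have h4 := cdf_le Q q.1 ⟪q.1, q.2⟫
      nlinarith
  have hint : ∀ a b : Measure (EuclideanSpace ℝ (Fin d)), IsProbabilityMeasure a →
      IsProbabilityMeasure b → Integrable (fun q : EuclideanSpace ℝ (Fin d) ×
        EuclideanSpace ℝ (Fin d) => projCDF a q.1 ⟪q.1, q.2⟫ + projCDF b q.1 ⟪q.1, q.2⟫
      - 2 * (projCDF a q.1 ⟪q.1, q.2⟫ * projCDF b q.1 ⟪q.1, q.2⟫))
        ((sphereUniform d).prod N) := by
    intro a b _ _
    refine Integrable.of_bound (((cdf_meas a).add (cdf_meas b)).sub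
      (((cdf_meas a).mul (cdf_meas b)).const_mul 2)).aestronglyMeasurable 1
      (Filter.Eventually.of_forall fun q => ?_)
    have h1 := cdf_nonneg a q.1 ⟪q.1, q.2⟫
    have h2 := cdf_nonneg b q.1 ⟪q.1, q.2⟫
    have h3 := cdf_le a q.1 ⟪q.1, q.2⟫
    have h4 := cdf_le b q.1 ⟪q.1, q.2⟫
    rw [Real.norm_eq_abs, abs_le]
    constructor <;> nlinarith [mul_nonneg h1 (sub_nonneg.2 h4), mul_nonneg h2 (sub_nonneg.2 h3),
      mul_nonneg (sub_nonneg.2 h3) (sub_nonneg.2 h4), mul_nonneg h1 h2]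
  rw [hW, angDist_int N hN, angDist_int N hN, angDist_int N hN, ← integral_const_mul,
    ← integral_const_mul,
    ← integral_sub ((hint P Q ‹_› ‹_›).const_mul 2) (hint P P ‹_› ‹_›),
    ← integral_sub (((hint P Q ‹_› ‹_›).const_mul 2).sub' (hint P P ‹_› ‹_›)) (hint Q Q ‹_› ‹_›)]
  congr 1
  ext q
  ring

end Aux

/-- Proposition 6.1: under the continuity assumption, with the angular
distance built from the mixture `ν = (1/2)P + (1/2)Q`,
`2 W_d²(P,Q) = 2 E[ρ_Angle(X,Y)] - E[ρ_Angle(X₁,X₂)] - E[ρ_Angle(Y₁,Y₂)]`. -/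
theorem stmt13 {d : ℕ} (P Q : Measure (EuclideanSpace ℝ (Fin d)))
    [IsProbabilityMeasure P] [IsProbabilityMeasure Q]
    (hc : ContinuityAssumption P Q) (ϑ : ℝ) (hϑ : ϑ ∈ Set.Ioo (0 : ℝ) 1) :
    2 * cvmSq ϑ P Q
      = 2 * (∫ x, ∫ y, angDist ((2 : ℝ≥0∞)⁻¹ • P + (2 : ℝ≥0∞)⁻¹ • Q) x y ∂Q ∂P)
        - (∫ x1, ∫ x2, angDist ((2 : ℝ≥0∞)⁻¹ • P + (2 : ℝ≥0∞)⁻¹ • Q) x1 x2 ∂P ∂P)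
        - (∫ y1, ∫ y2, angDist ((2 : ℝ≥0∞)⁻¹ • P + (2 : ℝ≥0∞)⁻¹ • Q) y1 y2 ∂Q ∂Q) := by
  exact Aux.main P Q hc ϑ hϑ
end
end

section
/- Let P_Z be a Borel probability measure on ℝ^d with P_Z({0}) = 0. Then ∫_{S^{d−1}} ( P_Z({z : ⟨β,z⟩ > 0}) − 1/2 )² dλ(β) = 1/4 − (1/(2π)) ∫∫ Ang(z1, z2) dP_Z(z1) dP_Z(z2). -/
open MeasureTheory ProbabilityTheory Real
open scoped RealInnerProductSpace ENNReal BigOperators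

noncomputable section

lemma gaussian_plane_cone (S : Set (ℝ × ℝ)) (hS : MeasurableSet S) (T : Set ℝ)
    (hT : MeasurableSet T) (hTsub : T ⊆ Set.Ioo (-π) π)
    (h : ∀ r φ : ℝ, 0 < r → φ ∈ Set.Ioo (-π) π → ((r * cos φ, r * sin φ) ∈ S ↔ φ ∈ T)) :
    ((gaussianReal 0 1).prod (gaussianReal 0 1)) S
      = (∫⁻ r in Set.Ioi (0 : ℝ), ENNReal.ofReal r * (gaussianPDF 0 1 r * gaussianPDF 0 1 0))
        * volume T := by
  have hm : Measurable (gaussianPDF 0 1) := measurable_gaussianPDF 0 1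
  rw [gaussianReal_of_var_ne_zero 0 one_ne_zero, prod_withDensity hm hm,
    withDensity_apply _ hS, ← lintegral_indicator hS, ← Measure.volume_eq_prod,
    ← lintegral_comp_polarCoord_symm, polarCoord_target]
  have e : ∀ p ∈ Set.Ioi (0 : ℝ) ×ˢ Set.Ioo (-π) π,
      ENNReal.ofReal p.1 • S.indicator (fun z : ℝ × ℝ => gaussianPDF 0 1 z.1 * gaussianPDF 0 1 z.2)
        (polarCoord.symm p)
      = (ENNReal.ofReal p.1 * (gaussianPDF 0 1 p.1 * gaussianPDF 0 1 0)) *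
        T.indicator (fun _ => 1) p.2 := by
    rintro ⟨r, φ⟩ ⟨hr, hφ⟩
    have hh := h r φ hr hφ
    simp only [polarCoord_symm_apply, smul_eq_mul]
    by_cases hc : φ ∈ T
    · rw [Set.indicator_of_mem (hh.2 hc), Set.indicator_of_mem hc, mul_one]
      congr 1
      simp only [gaussianPDF]
      rw [← ENNReal.ofReal_mul (gaussianPDFReal_nonneg _ _ _),
        ← ENNReal.ofReal_mul (gaussianPDFReal_nonneg _ _ _)]
      congr 1
      simp only [gaussianPDFReal]
      simp only [sub_zero]
      have eq1 : ∀ k a b : ℝ, k * rexp a * (k * rexp b) = k * k * rexp (a + b) := by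
        intro k a b
        rw [Real.exp_add]; ring
      rw [eq1, eq1]
      congr 2
      have := Real.sin_sq_add_cos_sq φ
      push_cast
      linear_combination (-(r ^ 2) / 2) * this
    · rw [Set.indicator_of_notMem (fun hx => hc (hh.1 hx)), Set.indicator_of_notMem hc]
      simp
  rw [setLIntegral_congr_fun (measurableSet_Ioi.prod measurableSet_Ioo) e,
    Measure.volume_eq_prod, ← Measure.prod_restrict,
    lintegral_prod_mul (f := fun r => ENNReal.ofReal r * (gaussianPDF 0 1 r * gaussianPDF 0 1 0))
      (g := T.indicator fun _ => 1) (by fun_prop)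
      ((measurable_const.indicator hT).aemeasurable)]
  congr 1
  rw [lintegral_indicator hT, setLIntegral_one, Measure.restrict_apply hT,
    Set.inter_eq_left.2 hTsub]

lemma gaussian_plane_angle (θ : ℝ) (h0 : 0 ≤ θ) (h1 : θ ≤ π) :
    ((gaussianReal 0 1).prod (gaussianReal 0 1)).real
      {p : ℝ × ℝ | 0 < p.1 ∧ 0 < p.1 * cos θ + p.2 * sin θ} = 1 / 2 - θ / (2 * π) := by
  have hp := Real.pi_pos
  have hu := gaussian_plane_cone Set.univ MeasurableSet.univ (Set.Ioo (-π) π) measurableSet_Ioo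
    subset_rfl (by simp)
  have hm : MeasurableSet {p : ℝ × ℝ | 0 < p.1 ∧ 0 < p.1 * cos θ + p.2 * sin θ} := by
    exact (measurableSet_lt measurable_const measurable_fst).inter
      (measurableSet_lt (g := fun p : ℝ × ℝ => p.1 * cos θ + p.2 * sin θ)
        measurable_const (by fun_prop))
  have hc := gaussian_plane_cone _ hm (Set.Ioo (θ - π / 2) (π / 2)) measurableSet_Ioo
    (Set.Ioo_subset_Ioo (by linarith) (by linarith)) (by
      intro r φ hr hφ
      have e : r * cos φ * cos θ + r * sin φ * sin θ = r * cos (φ - θ) := by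
        rw [Real.cos_sub]; ring
      simp only [Set.mem_ofPred_eq, e, Set.mem_Ioo, mul_pos_iff_of_pos_left hr]
      constructor
      · rintro ⟨ha, hb⟩
        have h2 : φ < π / 2 := by
          by_contra hcon
          have := Real.cos_nonpos_of_pi_div_two_le_of_le (not_lt.1 hcon) (by linarith [hφ.2])
          linarith
        have h3 : -(π / 2) < φ := by
          by_contra hcon
          have := Real.cos_nonpos_of_pi_div_two_le_of_le (x := -φ) (by linarith)
            (by linarith [hφ.1])
          rw [Real.cos_neg] at this
          linarith
        refine ⟨?_, h2⟩
        by_contra hcon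
        have := Real.cos_nonpos_of_pi_div_two_le_of_le (x := -(φ - θ)) (by linarith)
          (by linarith)
        rw [Real.cos_neg] at this
        linarith
      · rintro ⟨ha, hb⟩
        exact ⟨Real.cos_pos_of_mem_Ioo ⟨by linarith, hb⟩,
          Real.cos_pos_of_mem_Ioo ⟨by linarith, by linarith⟩⟩)
  set C := ∫⁻ r in Set.Ioi (0 : ℝ), ENNReal.ofReal r * (gaussianPDF 0 1 r * gaussianPDF 0 1 0)
  rw [measure_univ, Real.volume_Ioo] at hu
  rw [Real.volume_Ioo] at hc
  rw [measureReal_def, hc]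
  have hu' := congrArg ENNReal.toReal hu
  rw [ENNReal.toReal_mul, ENNReal.toReal_ofReal (by linarith), ENNReal.toReal_one] at hu'
  rw [ENNReal.toReal_mul, ENNReal.toReal_ofReal (by linarith)]
  have : C.toReal = 1 / (2 * π) := by
    field_simp
    linarith
  rw [this]
  field_simp
  ring

section
variable {d : ℕ}

lemma charFunDual_gaussian_one (L : StrongDual ℝ ℝ) :
    charFunDual (gaussianReal 0 1) L = Complex.exp (-(L 1 : ℂ) ^ 2 / 2) := by
  have h := charFun_gaussianReal (μ := 0) (v := 1) (L 1)
  rw [charFun_apply_real] at h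
  rw [charFunDual_apply]
  have e : ∀ x : ℝ, L x = L 1 * x := fun x => by
    have := L.map_smul x 1
    simp only [smul_eq_mul, mul_one] at this
    rw [this, mul_comm]
  have : (∫ x, Complex.exp ((L x : ℂ) * Complex.I) ∂(gaussianReal 0 1))
      = ∫ x : ℝ, Complex.exp ((L 1 : ℂ) * x * Complex.I) ∂(gaussianReal 0 1) := by
    refine integral_congr_ae (ae_of_all _ fun x => ?_)
    simp only
    rw [e x]
    push_cast
    rfl
  rw [this, h]
  congr 1
  push_cast
  ring

lemma gaussian_pair_law (u w : EuclideanSpace ℝ (Fin d)) (hu : ‖u‖ = 1) (hw : ‖w‖ = 1)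
    (huw : ⟪u, w⟫ = 0) :
    (ProbabilityTheory.stdGaussian (EuclideanSpace ℝ (Fin d))).map (fun β => (⟪u, β⟫, ⟪w, β⟫))
      = (gaussianReal 0 1).prod (gaussianReal 0 1) := by
  let A : EuclideanSpace ℝ (Fin d) →L[ℝ] ℝ × ℝ := (innerSL ℝ u).prod (innerSL ℝ w)
  have hA : (fun β => (⟪u, β⟫, ⟪w, β⟫)) = ⇑A := by ext β <;> simp [A]
  rw [hA]
  have : IsProbabilityMeasure
      ((ProbabilityTheory.stdGaussian (EuclideanSpace ℝ (Fin d))).map A) :=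
    Measure.isProbabilityMeasure_map (by fun_prop)
  apply Measure.ext_of_charFunDual
  ext L
  rw [charFunDual_map, charFunDual_prod, charFunDual_stdGaussian,
    charFunDual_gaussian_one, charFunDual_gaussian_one, ← Complex.exp_add]
  have hL : L.comp A = innerSL ℝ (L (1, 0) • u + L (0, 1) • w) := by
    ext β
    have : A β = ⟪u, β⟫ • (1, 0) + ⟪w, β⟫ • (0, 1) := by simp [A]
    simp only [ContinuousLinearMap.comp_apply, this, map_add, map_smul, smul_eq_mul]
    simp
    ring
  have hn : ‖L.comp A‖ ^ 2 = L (1, 0) ^ 2 + L (0, 1) ^ 2 := by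
    rw [hL, innerSL_apply_norm, @norm_add_sq_real]
    simp [norm_smul, inner_smul_left, inner_smul_right, huw, hu, hw]
  congr 1
  rw [← Complex.ofReal_pow, hn]
  simp
  ring

lemma gaussian_single_law (u : EuclideanSpace ℝ (Fin d)) (hu : ‖u‖ = 1) :
    (ProbabilityTheory.stdGaussian (EuclideanSpace ℝ (Fin d))).map (fun β => ⟪u, β⟫)
      = gaussianReal 0 1 := by
  have h := IsGaussian.map_eq_gaussianReal
    (μ := ProbabilityTheory.stdGaussian (EuclideanSpace ℝ (Fin d))) (innerSL ℝ u)
  rw [variance_dual_stdGaussian, integral_strongDual_stdGaussian, innerSL_apply_norm, hu] at h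
  simpa using h

lemma gaussian_angle (u v : EuclideanSpace ℝ (Fin d)) (hu : u ≠ 0) (hv : v ≠ 0) :
    (ProbabilityTheory.stdGaussian (EuclideanSpace ℝ (Fin d))).real
      {β | 0 < ⟪β, u⟫ ∧ 0 < ⟪β, v⟫} = 1 / 2 - Ang u v / (2 * π) := by
  have hu' := norm_pos_iff.2 hu
  have hv' := norm_pos_iff.2 hv
  set c := ⟪u, v⟫ / (‖u‖ * ‖v‖) with hc
  have hcabs := abs_le.1 (abs_real_inner_div_norm_mul_norm_le_one u v)
  have hcos : cos (Ang u v) = c := Real.cos_arccos hcabs.1 hcabs.2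
  have hplane := gaussian_plane_angle (Ang u v) (Real.arccos_nonneg _) (Real.arccos_le_pi _)
  set θ := Ang u v
  rw [← hplane]
  set u0 := ‖u‖⁻¹ • u with hu0
  set v0 := ‖v‖⁻¹ • v with hv0
  have nu : ‖u0‖ = 1 := by simp [hu0, norm_smul, hu'.ne']
  have nv : ‖v0‖ = 1 := by simp [hv0, norm_smul, hv'.ne']
  have huv : ⟪u0, v0⟫ = cos θ := by
    rw [hu0, hv0, real_inner_smul_left, real_inner_smul_right, hcos, hc]
    field_simp
  have hset : {β : EuclideanSpace ℝ (Fin d) | 0 < ⟪β, u⟫ ∧ 0 < ⟪β, v⟫}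
      = {β | 0 < ⟪u0, β⟫ ∧ 0 < ⟪v0, β⟫} := by
    ext β
    simp only [Set.mem_ofPred_eq, hu0, hv0, real_inner_smul_left,
      mul_pos_iff_of_pos_left (inv_pos.2 hu'), mul_pos_iff_of_pos_left (inv_pos.2 hv'),
      real_inner_comm β]
  rw [hset]
  clear_value u0 v0
  have uu : ⟪u0, u0⟫ = 1 := by rw [real_inner_self_eq_norm_sq, nu]; norm_num
  have vv : ⟪v0, v0⟫ = 1 := by rw [real_inner_self_eq_norm_sq, nv]; norm_num
  have hsc := Real.sin_sq_add_cos_sq θ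
  set q := v0 - cos θ • u0 with hq
  have hvq : v0 = cos θ • u0 + q := by rw [hq]; abel
  have huq : ⟪u0, q⟫ = 0 := by
    rw [hq, inner_sub_right, real_inner_smul_right, uu, huv]; ring
  have nq : ‖q‖ ^ 2 = sin θ ^ 2 := by
    rw [← real_inner_self_eq_norm_sq, hq, inner_sub_left, inner_sub_right, inner_sub_right,
      real_inner_smul_right, real_inner_smul_left, real_inner_smul_left, real_inner_smul_right,
      real_inner_comm u0 v0, uu, vv, huv]
    linarith
  have hm : MeasurableSet {p : ℝ × ℝ | 0 < p.1 ∧ 0 < p.1 * cos θ + p.2 * sin θ} :=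
    (measurableSet_lt measurable_const measurable_fst).inter
      (measurableSet_lt (g := fun p : ℝ × ℝ => p.1 * cos θ + p.2 * sin θ)
        measurable_const (by fun_prop))
  by_cases hs : sin θ = 0
  · have hq0 : q = 0 := by
      rw [hs] at nq
      simpa using nq
    have e1 : {p : ℝ × ℝ | 0 < p.1 ∧ 0 < p.1 * cos θ + p.2 * sin θ}
        = {x : ℝ | 0 < x ∧ 0 < x * cos θ} ×ˢ Set.univ := by
      ext p
      simp [hs]
    have hm1 : MeasurableSet {x : ℝ | 0 < x ∧ 0 < x * cos θ} :=
      (measurableSet_lt measurable_const measurable_id).inter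
        (measurableSet_lt (g := fun x : ℝ => x * cos θ) measurable_const (by fun_prop))
    rw [e1, measureReal_prod_prod, ← gaussian_single_law u0 nu,
      map_measureReal_apply (by fun_prop) hm1]
    have : IsProbabilityMeasure ((ProbabilityTheory.stdGaussian
      (EuclideanSpace ℝ (Fin d))).map (fun β => ⟪u0, β⟫)) :=
      Measure.isProbabilityMeasure_map (by fun_prop)
    rw [probReal_univ, mul_one]
    congr 1
    ext β
    simp [hvq, hq0, real_inner_smul_left, mul_comm]
  · have nw : ‖(sin θ)⁻¹ • q‖ = 1 := by
      have : ‖(sin θ)⁻¹ • q‖ ^ 2 = 1 := by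
        rw [norm_smul, mul_pow, nq, Real.norm_eq_abs, sq_abs]
        field_simp
      nlinarith [norm_nonneg ((sin θ)⁻¹ • q)]
    have huw : ⟪u0, (sin θ)⁻¹ • q⟫ = 0 := by rw [real_inner_smul_right, huq, mul_zero]
    rw [← gaussian_pair_law u0 ((sin θ)⁻¹ • q) nu nw huw, map_measureReal_apply (by fun_prop) hm]
    congr 1
    ext β
    simp only [Set.mem_ofPred_eq, Set.mem_preimage, hvq, inner_add_left, real_inner_smul_left]
    have : (sin θ)⁻¹ * ⟪q, β⟫ * sin θ = ⟪q, β⟫ := by field_simp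
    rw [this, mul_comm (cos θ)]

lemma fubini_sets {E X : Type*} [MeasurableSpace E] [MeasurableSpace X] (μ : Measure E)
    (ν : Measure X) [IsProbabilityMeasure μ] [IsProbabilityMeasure ν] (A : Set (E × X))
    (hA : MeasurableSet A) :
    ∫ β, ν.real {x | (β, x) ∈ A} ∂μ = ∫ x, μ.real {β | (β, x) ∈ A} ∂ν := by
  change ∫ β, (ν (Prod.mk β ⁻¹' A)).toReal ∂μ = ∫ x, (μ ((fun β => (β, x)) ⁻¹' A)).toReal ∂ν
  rw [integral_toReal (measurable_measure_prodMk_left hA).aemeasurable (by simp),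
    integral_toReal (measurable_measure_prodMk_right hA).aemeasurable (by simp)]
  congr 1
  exact (Measure.prod_apply hA).symm.trans (Measure.prod_apply_symm hA)

lemma stdGaussian_eq_mathlib :
    _root_.stdGaussian d = ProbabilityTheory.stdGaussian (EuclideanSpace ℝ (Fin d)) := by
  rw [← map_pi_eq_stdGaussian]
  rfl
end

/-- Proposition 7.1, one-sample sign statistic: if `P_Z({0}) = 0`, then
`∫_{S^{d-1}} (P_Z{z : ⟪β,z⟫ > 0} - 1/2)² dλ(β) = 1/4 - (1/(2π)) E[Ang(Z₁, Z₂)]`. -/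
theorem stmt14 {d : ℕ} (PZ : Measure (EuclideanSpace ℝ (Fin d))) [IsProbabilityMeasure PZ]
    (h0 : PZ {0} = 0) :
    (∫ β, ((PZ {z | 0 < ⟪β, z⟫}).toReal - 1 / 2) ^ 2 ∂(sphereUniform d))
      = 1 / 4 - (1 / (2 * π)) * (∫ z1, ∫ z2, Ang z1 z2 ∂PZ ∂PZ) := by
  have hpi := Real.pi_pos
  set γ := ProbabilityTheory.stdGaussian (EuclideanSpace ℝ (Fin d)) with hγ
  have hset : MeasurableSet {p : EuclideanSpace ℝ (Fin d) × EuclideanSpace ℝ (Fin d) |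
      0 < ⟪p.1, p.2⟫} := measurableSet_lt measurable_const (by fun_prop)
  have hset2 : MeasurableSet {p : EuclideanSpace ℝ (Fin d) ×
      (EuclideanSpace ℝ (Fin d) × EuclideanSpace ℝ (Fin d)) |
      0 < ⟪p.1, p.2.1⟫ ∧ 0 < ⟪p.1, p.2.2⟫} := by
    exact (measurableSet_lt (g := fun p : EuclideanSpace ℝ (Fin d) ×
        (EuclideanSpace ℝ (Fin d) × EuclideanSpace ℝ (Fin d)) => ⟪p.1, p.2.1⟫)
        measurable_const (by fun_prop)).inter
      (measurableSet_lt (g := fun p : EuclideanSpace ℝ (Fin d) ×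
        (EuclideanSpace ℝ (Fin d) × EuclideanSpace ℝ (Fin d)) => ⟪p.1, p.2.2⟫)
        measurable_const (by fun_prop))
  have hPm : Measurable (fun β : EuclideanSpace ℝ (Fin d) => PZ.real {z | 0 < ⟪β, z⟫}) :=
    (measurable_measure_prodMk_left hset).ennreal_toReal
  have hAm : Measurable (fun p : EuclideanSpace ℝ (Fin d) × EuclideanSpace ℝ (Fin d) =>
      Ang p.1 p.2) := by
    unfold Ang
    exact Real.continuous_arccos.measurable.comp (by fun_prop)
  have hAint : Integrable (fun p : EuclideanSpace ℝ (Fin d) × EuclideanSpace ℝ (Fin d) =>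
      Ang p.1 p.2) (PZ.prod PZ) := by
    refine Integrable.of_bound hAm.aestronglyMeasurable π (ae_of_all _ fun p => ?_)
    rw [Real.norm_eq_abs, Ang, abs_of_nonneg (Real.arccos_nonneg _)]
    exact Real.arccos_le_pi _
  have hne : ∀ᵐ z ∂PZ, z ≠ 0 := by
    rw [ae_iff]; simpa using h0
  have hne2 : ∀ᵐ p ∂(PZ.prod PZ), p.1 ≠ 0 ∧ p.2 ≠ 0 :=
    (Measure.quasiMeasurePreserving_fst.ae hne).and (Measure.quasiMeasurePreserving_snd.ae hne)
  have step1 : (∫ β, ((PZ {z | 0 < ⟪β, z⟫}).toReal - 1 / 2) ^ 2 ∂(sphereUniform d))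
      = ∫ β, (PZ.real {z | 0 < ⟪β, z⟫} - 1 / 2) ^ 2 ∂γ := by
    rw [sphereUniform, stdGaussian_eq_mathlib, integral_map (by fun_prop)]
    · refine integral_congr_ae (ae_of_all _ fun β => ?_)
      have : {z | 0 < ⟪‖β‖⁻¹ • β, z⟫} = {z | 0 < ⟪β, z⟫} := by
        by_cases hβ : β = 0
        · simp [hβ]
        · ext z
          have : 0 < ‖β‖⁻¹ := inv_pos.2 (norm_pos_iff.2 hβ)
          simp only [Set.mem_ofPred_eq, real_inner_smul_left, mul_pos_iff_of_pos_left this]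
      simp only [this, measureReal_def]
    · exact ((hPm.sub_const _).pow_const 2).aestronglyMeasurable
  have step2 : ∫ β, PZ.real {z | 0 < ⟪β, z⟫} ∂γ = 1 / 2 := by
    have := fubini_sets γ PZ _ hset
    simp only [Set.mem_ofPred_eq] at this
    rw [this, integral_congr_ae (g := fun _ => 1 / 2)]
    · simp
    · filter_upwards [hne] with z hz
      have h := gaussian_angle z z hz hz
      simp only [and_self] at h
      rw [h, Ang, real_inner_self_eq_norm_mul_norm, div_self, Real.arccos_one]
      · simp
      · simpa using hz
  have step3 : ∫ β, PZ.real {z | 0 < ⟪β, z⟫} ^ 2 ∂γ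
      = 1 / 2 - (1 / (2 * π)) * (∫ z1, ∫ z2, Ang z1 z2 ∂PZ ∂PZ) := by
    have h := fubini_sets γ (PZ.prod PZ) _ hset2
    simp only [Set.mem_ofPred_eq] at h
    have h' : ∀ β : EuclideanSpace ℝ (Fin d), PZ.real {z | 0 < ⟪β, z⟫} ^ 2
        = (PZ.prod PZ).real {p | 0 < ⟪β, p.1⟫ ∧ 0 < ⟪β, p.2⟫} := by
      intro β
      rw [sq, ← measureReal_prod_prod]
      rfl
    simp only [h']
    rw [h, integral_congr_ae (g := fun p => 1 / 2 - (1 / (2 * π)) * Ang p.1 p.2)]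
    · rw [integral_sub (integrable_const _) (hAint.const_mul _), integral_const_mul,
        integral_prod _ hAint]
      simp
    · filter_upwards [hne2] with p hp
      rw [gaussian_angle p.1 p.2 hp.1 hp.2]
      ring
  rw [step1]
  have hb : ∀ β : EuclideanSpace ℝ (Fin d), ‖PZ.real {z | 0 < ⟪β, z⟫}‖ ≤ 1 := fun β => by
    rw [Real.norm_eq_abs, abs_of_nonneg measureReal_nonneg]
    exact measureReal_le_one
  have i1 : Integrable (fun β => PZ.real {z | 0 < ⟪β, z⟫}) γ :=
    Integrable.of_bound hPm.aestronglyMeasurable 1 (ae_of_all _ hb)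
  have i2 : Integrable (fun β => PZ.real {z | 0 < ⟪β, z⟫} ^ 2) γ :=
    Integrable.of_bound (hPm.pow_const 2).aestronglyMeasurable 1 (ae_of_all _ fun β => by
      rw [norm_pow]; exact pow_le_one₀ (norm_nonneg _) (hb β))
  have e : ∀ β : EuclideanSpace ℝ (Fin d), (PZ.real {z | 0 < ⟪β, z⟫} - 1 / 2) ^ 2
      = PZ.real {z | 0 < ⟪β, z⟫} ^ 2 - PZ.real {z | 0 < ⟪β, z⟫} + 1 / 4 := fun β => by ring
  simp only [e]
  rw [integral_add (by exact i2.sub i1) (integrable_const _), integral_sub i2 i1, step2, step3]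
  simp
  ring
end
end

section
/- Let P, Q be Borel probability measures on ℝ^d such that (P ⊗ Q)({(x,y) : x = y}) = 0. Let X1, X2 be i.i.d. with law P and, independently, Y1, Y2 i.i.d. with law Q. Then ∫_{S^{d−1}} ( (P ⊗ Q)({(x,y) : ⟨β,x⟩ > ⟨β,y⟩}) − 1/2 )² dλ(β) = 1/4 − (1/(2π))·E[ Ang(X1 − Y1, X2 − Y2) ]. -/
open MeasureTheory ProbabilityTheory Real
open scoped RealInnerProductSpace ENNReal BigOperators

noncomputable section

lemma pairLaw_charFun {d : ℕ} (u v : EuclideanSpace ℝ (Fin d)) (a b c : ℝ)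
    (h : ∀ s t : ℝ, ‖s • u + t • v‖ ^ 2 = (s * a + t * b) ^ 2 + (t * c) ^ 2) :
    (_root_.stdGaussian d).map (fun g => (⟪g, u⟫, ⟪g, v⟫))
      = ((gaussianReal 0 1).prod (gaussianReal 0 1)).map
        (fun p : ℝ × ℝ => (a * p.1, b * p.1 + c * p.2)) := by
  have hstd : _root_.stdGaussian d
      = ProbabilityTheory.stdGaussian (EuclideanSpace ℝ (Fin d)) := by
    rw [← map_pi_eq_stdGaussian]; rfl
  rw [hstd]
  have : IsProbabilityMeasure (((gaussianReal 0 1).prod (gaussianReal 0 1)).map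
        (fun p : ℝ × ℝ => (a * p.1, b * p.1 + c * p.2))) :=
    Measure.isProbabilityMeasure_map (by fun_prop)
  have : IsProbabilityMeasure
      ((ProbabilityTheory.stdGaussian (EuclideanSpace ℝ (Fin d))).map
        (fun g => (⟪g, u⟫, ⟪g, v⟫))) :=
    Measure.isProbabilityMeasure_map (by fun_prop)
  apply Measure.ext_of_charFunDual
  ext L
  have hL : ∀ x y : ℝ, L (x, y) = x * L (1, 0) + y * L (0, 1) := by
    intro x y
    have : ((x, y) : ℝ × ℝ) = x • (1, 0) + y • (0, 1) := by simp
    rw [this, map_add, map_smul, map_smul]; simp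
  set s := L (1, 0)
  set t := L (0, 1)
  rw [charFunDual_apply, charFunDual_apply, integral_map (by fun_prop) (by fun_prop),
    integral_map (by fun_prop) (by fun_prop)]
  simp_rw [hL]
  have h1 : ∫ g, Complex.exp (((⟪g, u⟫ * s + ⟪g, v⟫ * t : ℝ) : ℂ) * Complex.I)
      ∂(ProbabilityTheory.stdGaussian (EuclideanSpace ℝ (Fin d)))
      = charFun (ProbabilityTheory.stdGaussian (EuclideanSpace ℝ (Fin d))) (s • u + t • v) := by
    rw [charFun_apply]
    congr 1; ext g
    rw [inner_add_right, inner_smul_right, inner_smul_right]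
    congr 4 <;> ring
  rw [h1, charFun_stdGaussian]
  have h2 : ∀ p : ℝ × ℝ, Complex.exp (((a * p.1 * s + (b * p.1 + c * p.2) * t : ℝ) : ℂ) * Complex.I)
     = Complex.exp (((s * a + t * b : ℝ) : ℂ) * p.1 * Complex.I) *
       Complex.exp (((t * c : ℝ) : ℂ) * p.2 * Complex.I) := by
    intro p
    rw [← Complex.exp_add]; congr 1; push_cast; ring
  simp_rw [h2]
  rw [integral_prod_mul (fun x : ℝ => Complex.exp (((s * a + t * b : ℝ) : ℂ) * x * Complex.I))
    (fun x : ℝ => Complex.exp (((t * c : ℝ) : ℂ) * x * Complex.I)), ← charFun_apply_real,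
    ← charFun_apply_real, charFun_gaussianReal, charFun_gaussianReal, ← Complex.exp_add]
  congr 1
  rw [← Complex.ofReal_pow, h]
  push_cast
  ring

lemma gauss2_sector (A : Set ℝ) (hA : MeasurableSet A) (B : Set (ℝ × ℝ)) (hB : MeasurableSet B)
    (h : ∀ r φ : ℝ, 0 < r → φ ∈ Set.Ioo (-π) π →
      ((r * Real.cos φ, r * Real.sin φ) ∈ B ↔ φ ∈ A)) :
    ((gaussianReal 0 1).prod (gaussianReal 0 1)) B
      = (∫⁻ r in Set.Ioi (0:ℝ), ENNReal.ofReal r *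
          ENNReal.ofReal ((√(2 * π))⁻¹ * (√(2 * π))⁻¹ * Real.exp (- r ^ 2 / 2)))
        * volume (A ∩ Set.Ioo (-π) π) := by
  rw [gaussianReal_of_var_ne_zero _ one_ne_zero,
    prod_withDensity (measurable_gaussianPDF _ _) (measurable_gaussianPDF _ _),
    withDensity_apply _ hB, ← lintegral_indicator hB, ← Measure.volume_eq_prod,
    ← lintegral_comp_polarCoord_symm]
  have hT : polarCoord.target = Set.Ioi (0:ℝ) ×ˢ Set.Ioo (-π) π := rfl
  have key : ∀ p ∈ polarCoord.target, ENNReal.ofReal p.1 •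
      B.indicator (fun z : ℝ × ℝ => gaussianPDF 0 1 z.1 * gaussianPDF 0 1 z.2) (polarCoord.symm p)
      = (ENNReal.ofReal p.1 *
          ENNReal.ofReal ((√(2 * π))⁻¹ * (√(2 * π))⁻¹ * Real.exp (- p.1 ^ 2 / 2)))
        * A.indicator 1 p.2 := by
    rintro ⟨r, φ⟩ hp
    rw [hT] at hp
    obtain ⟨hr, hφ⟩ := hp
    simp only at hr hφ
    have h' := h r φ hr hφ
    have : polarCoord.symm (r, φ) = (r * Real.cos φ, r * Real.sin φ) := rfl
    rw [this]
    by_cases hm : φ ∈ A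
    · rw [Set.indicator_of_mem (h'.2 hm), Set.indicator_of_mem hm]
      simp only [gaussianPDF, gaussianPDFReal, Pi.one_apply, mul_one, smul_eq_mul]
      rw [← ENNReal.ofReal_mul (by positivity)]
      congr 2
      simp only [NNReal.coe_one, mul_one, sub_zero]
      rw [mul_mul_mul_comm, ← Real.exp_add]
      congr 2
      have := Real.sin_sq_add_cos_sq φ
      linear_combination (-r ^ 2 / 2) * this
    · rw [Set.indicator_of_notMem (fun hh => hm (h'.1 hh)), Set.indicator_of_notMem hm]
      simp
  rw [setLIntegral_congr_fun polarCoord.open_target.measurableSet key, hT,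
    Measure.volume_eq_prod, ← Measure.prod_restrict,
    lintegral_prod_mul (f := fun r : ℝ => ENNReal.ofReal r *
          ENNReal.ofReal ((√(2 * π))⁻¹ * (√(2 * π))⁻¹ * Real.exp (- r ^ 2 / 2)))
      (g := A.indicator 1) (by fun_prop) (by
        exact (measurable_one.indicator hA).aemeasurable),
    lintegral_indicator_one hA, Measure.restrict_apply hA]

lemma gauss2_angle (A : Set ℝ) (hA : MeasurableSet A) (B : Set (ℝ × ℝ)) (hB : MeasurableSet B)
    (h : ∀ r φ : ℝ, 0 < r → φ ∈ Set.Ioo (-π) π →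
      ((r * Real.cos φ, r * Real.sin φ) ∈ B ↔ φ ∈ A)) :
    ((gaussianReal 0 1).prod (gaussianReal 0 1)).real B
      = volume.real (A ∩ Set.Ioo (-π) π) / (2 * π) := by
  have h1 := gauss2_sector A hA B hB h
  have h2 := gauss2_sector Set.univ MeasurableSet.univ Set.univ MeasurableSet.univ (by simp)
  set R := (∫⁻ r in Set.Ioi (0:ℝ), ENNReal.ofReal r *
          ENNReal.ofReal ((√(2 * π))⁻¹ * (√(2 * π))⁻¹ * Real.exp (- r ^ 2 / 2)))
  have h3 : R.toReal * (2 * π) = 1 := by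
    rw [measure_univ, Set.univ_inter, Real.volume_Ioo] at h2
    have := congrArg ENNReal.toReal h2
    rw [ENNReal.toReal_mul, ENNReal.toReal_ofReal (by linarith [pi_pos])] at this
    simp at this
    linarith
  rw [measureReal_def, h1, ENNReal.toReal_mul, measureReal_def]
  have : R.toReal = 1 / (2 * π) := by
    field_simp; linarith
  rw [this]; ring

lemma orthant {d : ℕ} (u v : EuclideanSpace ℝ (Fin d)) (hu : u ≠ 0) (hv : v ≠ 0) :
    (_root_.stdGaussian d).real {g | 0 < ⟪g, u⟫ ∧ 0 < ⟪g, v⟫} = 1 / 2 - 1 / (2 * π) * Ang u v := by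
  set θ := Ang u v with hθ
  have hθ0 : 0 ≤ θ := Real.arccos_nonneg _
  have hθπ : θ ≤ π := Real.arccos_le_pi _
  have hu' : 0 < ‖u‖ := norm_pos_iff.2 hu
  have hv' : 0 < ‖v‖ := norm_pos_iff.2 hv
  have hcos : ‖u‖ * ‖v‖ * Real.cos θ = ⟪u, v⟫ := by
    have : Real.cos θ = ⟪u, v⟫ / (‖u‖ * ‖v‖) := InnerProductGeometry.cos_angle u v
    rw [this]; field_simp
  have hlaw := pairLaw_charFun u v ‖u‖ (‖v‖ * Real.cos θ) (‖v‖ * Real.sin θ) (by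
    intro s t
    rw [norm_add_sq_real, norm_smul, norm_smul, mul_pow, mul_pow, inner_smul_left,
      inner_smul_right, ← hcos]
    simp only [Real.norm_eq_abs, sq_abs, conj_trivial]
    linear_combination (-t ^ 2 * ‖v‖ ^ 2) * Real.sin_sq_add_cos_sq θ)
  have hO : MeasurableSet {p : ℝ × ℝ | 0 < p.1 ∧ 0 < p.2} :=
    (measurableSet_lt measurable_const measurable_fst).inter
      (measurableSet_lt measurable_const measurable_snd)
  have e1 : (_root_.stdGaussian d).real {g | 0 < ⟪g, u⟫ ∧ 0 < ⟪g, v⟫}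
      = ((_root_.stdGaussian d).map (fun g => (⟪g, u⟫, ⟪g, v⟫))).real
        {p : ℝ × ℝ | 0 < p.1 ∧ 0 < p.2} := by
    rw [map_measureReal_apply (by fun_prop) hO]; rfl
  have hm : Measurable (fun p : ℝ × ℝ =>
    (‖u‖ * p.1, ‖v‖ * Real.cos θ * p.1 + ‖v‖ * Real.sin θ * p.2)) := by fun_prop
  rw [e1, hlaw, map_measureReal_apply hm hO,
    gauss2_angle (Set.Ioo (θ - π / 2) (π / 2)) measurableSet_Ioo _ (hm hO)]
  · have : Set.Ioo (θ - π / 2) (π / 2) ∩ Set.Ioo (-π) π = Set.Ioo (θ - π / 2) (π / 2) := by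
      apply Set.inter_eq_left.2
      apply Set.Ioo_subset_Ioo <;> linarith [pi_pos]
    rw [this, Real.volume_real_Ioo_of_le (by linarith)]
    field_simp
    ring
  · intro r φ hr hφ
    have e2 : ‖v‖ * Real.cos θ * (r * Real.cos φ) + ‖v‖ * Real.sin θ * (r * Real.sin φ)
        = ‖v‖ * r * Real.cos (φ - θ) := by rw [Real.cos_sub]; ring
    simp only [Set.mem_preimage, Set.mem_ofPred_eq, Set.mem_Ioo, e2]
    rw [mul_pos_iff_of_pos_left hu', mul_pos_iff_of_pos_left hr,
      mul_pos_iff_of_pos_left (by positivity)]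
    obtain ⟨hφ1, hφ2⟩ := hφ
    constructor
    · rintro ⟨h1, h2⟩
      have a1 : φ < π / 2 := by
        by_contra! hc
        exact absurd h1 (not_lt.2 (Real.cos_nonpos_of_pi_div_two_le_of_le hc (by linarith)))
      have a2 : -(π / 2) < φ := by
        by_contra! hc
        rw [← Real.cos_neg] at h1
        exact absurd h1 (not_lt.2 (Real.cos_nonpos_of_pi_div_two_le_of_le
          (by linarith) (by linarith)))
      refine ⟨?_, a1⟩
      by_contra! hc
      rw [← Real.cos_neg] at h2
      exact absurd h2 (not_lt.2 (Real.cos_nonpos_of_pi_div_two_le_of_le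
          (by linarith) (by linarith)))
    · rintro ⟨h1, h2⟩
      exact ⟨Real.cos_pos_of_mem_Ioo ⟨by linarith, by linarith⟩,
        Real.cos_pos_of_mem_Ioo ⟨by linarith, by linarith⟩⟩

lemma halfspace {d : ℕ} (u : EuclideanSpace ℝ (Fin d)) (hu : u ≠ 0) :
    (_root_.stdGaussian d).real {g | 0 < ⟪g, u⟫} = 1 / 2 := by
  have h := orthant u u hu hu
  have h0 : Ang u u = 0 := InnerProductGeometry.angle_self hu
  simpa [h0] using h

lemma integral_slice_swap {α β : Type*} [MeasurableSpace α] [MeasurableSpace β]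
    (μ : Measure α) (ν : Measure β) [IsProbabilityMeasure μ] [IsProbabilityMeasure ν]
    (T : Set (α × β)) (hT : MeasurableSet T) :
    ∫ a, ν.real {b | (a, b) ∈ T} ∂μ = ∫ b, μ.real {a | (a, b) ∈ T} ∂ν := by
  have h1 := Measure.prod_apply (μ := μ) (ν := ν) hT
  have h2 := Measure.prod_apply_symm (μ := μ) (ν := ν) hT
  change ∫ a, (ν (Prod.mk a ⁻¹' T)).toReal ∂μ = ∫ b, (μ ((fun x => (x, b)) ⁻¹' T)).toReal ∂ν
  rw [integral_toReal (measurable_measure_prodMk_left hT).aemeasurable (by simp),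
    integral_toReal (measurable_measure_prodMk_right hT).aemeasurable (by simp)]
  exact congrArg ENNReal.toReal (h1.symm.trans h2)

lemma measurable_Ang {d : ℕ} :
    Measurable (fun p : EuclideanSpace ℝ (Fin d) × EuclideanSpace ℝ (Fin d) => Ang p.1 p.2) := by
  unfold Ang
  exact Real.measurable_arccos.comp (by fun_prop)

lemma Ang_bound {d : ℕ} (u v : EuclideanSpace ℝ (Fin d)) : ‖Ang u v‖ ≤ π := by
  rw [Real.norm_eq_abs, abs_of_nonneg (show 0 ≤ Ang u v from Real.arccos_nonneg _)]
  exact Real.arccos_le_pi _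

lemma Ang_reorder {d : ℕ} (P Q : Measure (EuclideanSpace ℝ (Fin d)))
    [IsProbabilityMeasure P] [IsProbabilityMeasure Q] :
    ∫ w, Ang (w.1.1 - w.1.2) (w.2.1 - w.2.2) ∂((P.prod Q).prod (P.prod Q))
      = ∫ x1, ∫ x2, ∫ y1, ∫ y2, Ang (x1 - y1) (x2 - y2) ∂Q ∂Q ∂P ∂P := by
  have hi : ∀ {α : Type} [MeasurableSpace α] (μ : Measure α) [IsProbabilityMeasure μ]
      (f g : α → EuclideanSpace ℝ (Fin d)), Measurable f → Measurable g →
      Integrable (fun a => Ang (f a) (g a)) μ := by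
    intro α _ μ _ f g hf hg
    exact Integrable.of_bound (measurable_Ang.comp (hf.prodMk hg)).aestronglyMeasurable π
      (Filter.Eventually.of_forall fun a => Ang_bound _ _)
  have h4 := hi ((P.prod Q).prod (P.prod Q)) (fun w => w.1.1 - w.1.2) (fun w => w.2.1 - w.2.2)
    (by fun_prop) (by fun_prop)
  rw [integral_prod _ h4, integral_prod _ h4.integral_prod_left]
  congr 1; ext x1
  have h3 := hi ((Q.prod P).prod Q) (fun w => x1 - w.1.1) (fun w => w.1.2 - w.2)
    (by fun_prop) (by fun_prop)
  rw [← integral_integral_swap (f := fun y1 x2 => ∫ y2, Ang (x1 - y1) (x2 - y2) ∂Q)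
    h3.integral_prod_left]
  congr 1; ext y1
  exact integral_prod _ (hi (P.prod Q) (fun w => x1 - y1) (fun w => w.1 - w.2)
    (by fun_prop) (by fun_prop))


/-- Proposition 7.2, two-sample Wilcoxon–Mann–Whitney statistic: if
`(P ⊗ Q){(x,y) : x = y} = 0` then, with `X₁,X₂ ~ P` i.i.d. and independently `Y₁,Y₂ ~ Q` i.i.d.,
`∫_{S^{d-1}} ((P⊗Q){(x,y) : ⟪β,x⟫ > ⟪β,y⟫} - 1/2)² dλ(β)
  = 1/4 - (1/(2π)) E[Ang(X₁-Y₁, X₂-Y₂)]`. -/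
theorem stmt15 {d : ℕ} (P Q : Measure (EuclideanSpace ℝ (Fin d)))
    [IsProbabilityMeasure P] [IsProbabilityMeasure Q]
    (hne : (P.prod Q) {z | z.1 = z.2} = 0) :
    (∫ β, (((P.prod Q) {z | ⟪β, z.2⟫ < ⟪β, z.1⟫}).toReal - 1 / 2) ^ 2 ∂(sphereUniform d))
      = 1 / 4
        - (1 / (2 * π)) * (∫ x1, ∫ x2, ∫ y1, ∫ y2, Ang (x1 - y1) (x2 - y2) ∂Q ∂Q ∂P ∂P) := by
  set ρ := P.prod Q with hρ
  have hprob : IsProbabilityMeasure (_root_.stdGaussian d) :=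
    Measure.isProbabilityMeasure_map (by fun_prop)
  set μ := _root_.stdGaussian d with hμ
  set F : EuclideanSpace ℝ (Fin d) → ℝ := fun β => ρ.real {z | ⟪β, z.2⟫ < ⟪β, z.1⟫} with hF
  have hS : MeasurableSet {p : EuclideanSpace ℝ (Fin d) ×
      (EuclideanSpace ℝ (Fin d) × EuclideanSpace ℝ (Fin d)) | ⟪p.1, p.2.2⟫ < ⟪p.1, p.2.1⟫} :=
    measurableSet_lt (by fun_prop) (by fun_prop)
  have hFm : Measurable F := (measurable_measure_prodMk_left hS).ennreal_toReal
  have hF1 : ∀ g, ‖F g‖ ≤ 1 := fun g => by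
    rw [Real.norm_eq_abs, abs_of_nonneg measureReal_nonneg]; exact measureReal_le_one
  have hFi : Integrable F μ := Integrable.of_bound hFm.aestronglyMeasurable 1
    (Filter.Eventually.of_forall hF1)
  have hFi2 : Integrable (fun g => F g ^ 2) μ :=
    Integrable.of_bound (hFm.pow_const 2).aestronglyMeasurable 1
    (Filter.Eventually.of_forall fun g => by
      rw [norm_pow]; exact pow_le_one₀ (norm_nonneg _) (hF1 g))
  have hscale : ∀ g, F (‖g‖⁻¹ • g) = F g := by
    intro g
    rcases eq_or_ne g 0 with rfl | hg
    · simp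
    · have : 0 < ‖g‖⁻¹ := inv_pos.2 (norm_pos_iff.2 hg)
      simp only [hF]
      congr 1
      ext z
      simp only [Set.mem_ofPred_eq, real_inner_smul_left]
      exact mul_lt_mul_iff_right₀ this
  have hL : (∫ β, ((ρ {z | ⟪β, z.2⟫ < ⟪β, z.1⟫}).toReal - 1 / 2) ^ 2 ∂(sphereUniform d))
      = ∫ g, (F g - 1 / 2) ^ 2 ∂μ := by
    change ∫ β, (F β - 1 / 2) ^ 2 ∂(μ.map fun x => ‖x‖⁻¹ • x) = _
    rw [integral_map (by fun_prop)
      ((hFm.sub_const _).pow_const 2).aestronglyMeasurable]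
    simp_rw [hscale]
  have hae : ∀ᵐ z ∂ρ, z.1 - z.2 ≠ 0 := by
    have : ∀ᵐ z ∂ρ, ¬ (z.1 = z.2) := by
      rw [ae_iff]; simpa using hne
    filter_upwards [this] with z hz using sub_ne_zero.2 hz
  have hInt1 : ∫ g, F g ∂μ = 1 / 2 := by
    have h := integral_slice_swap μ ρ _ hS
    simp only [Set.mem_ofPred_eq] at h
    rw [hF, h, integral_congr_ae (g := fun _ => (1 / 2 : ℝ))]
    · simp
    · filter_upwards [hae] with z hz
      rw [← halfspace _ hz]
      simp only [inner_sub_right, sub_pos]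
      rfl
  have hInt2 : ∫ g, F g ^ 2 ∂μ = 1 / 2 - 1 / (2 * π) *
      ∫ w, Ang (w.1.1 - w.1.2) (w.2.1 - w.2.2) ∂(ρ.prod ρ) := by
    have hT : MeasurableSet {p : EuclideanSpace ℝ (Fin d) ×
      ((EuclideanSpace ℝ (Fin d) × EuclideanSpace ℝ (Fin d)) ×
        (EuclideanSpace ℝ (Fin d) × EuclideanSpace ℝ (Fin d))) |
        ⟪p.1, p.2.1.2⟫ < ⟪p.1, p.2.1.1⟫ ∧ ⟪p.1, p.2.2.2⟫ < ⟪p.1, p.2.2.1⟫} := by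
      rw [Set.setOf_and]
      exact (measurableSet_lt (by fun_prop) (by fun_prop)).inter
        (measurableSet_lt (by fun_prop) (by fun_prop))
    have h := integral_slice_swap μ (ρ.prod ρ) _ hT
    simp only [Set.mem_ofPred_eq] at h
    have hsq : ∀ g, F g ^ 2 = (ρ.prod ρ).real {w | ⟪g, w.1.2⟫ < ⟪g, w.1.1⟫ ∧
        ⟪g, w.2.2⟫ < ⟪g, w.2.1⟫} := by
      intro g
      rw [sq, hF, ← measureReal_prod_prod]
      rfl
    have hAi : Integrable (fun w : (EuclideanSpace ℝ (Fin d) × EuclideanSpace ℝ (Fin d)) ×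
        (EuclideanSpace ℝ (Fin d) × EuclideanSpace ℝ (Fin d)) =>
        Ang (w.1.1 - w.1.2) (w.2.1 - w.2.2)) (ρ.prod ρ) :=
      Integrable.of_bound (measurable_Ang.comp (f := fun w :
          (EuclideanSpace ℝ (Fin d) × EuclideanSpace ℝ (Fin d)) ×
          (EuclideanSpace ℝ (Fin d) × EuclideanSpace ℝ (Fin d)) =>
          (w.1.1 - w.1.2, w.2.1 - w.2.2)) (by fun_prop)).aestronglyMeasurable π
        (Filter.Eventually.of_forall fun a => Ang_bound _ _)
    simp_rw [hsq]
    rw [h, integral_congr_ae (g := fun w => 1 / 2 - 1 / (2 * π) *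
      Ang (w.1.1 - w.1.2) (w.2.1 - w.2.2)), integral_sub (integrable_const _) (hAi.const_mul _),
      integral_const_mul]
    · simp
    · have h1 : ∀ᵐ w ∂(ρ.prod ρ), w.1.1 - w.1.2 ≠ 0 :=
        Measure.quasiMeasurePreserving_fst.ae hae
      have h2 : ∀ᵐ w ∂(ρ.prod ρ), w.2.1 - w.2.2 ≠ 0 :=
        Measure.quasiMeasurePreserving_snd.ae hae
      filter_upwards [h1, h2] with w hw1 hw2
      rw [← orthant _ _ hw1 hw2]
      simp only [inner_sub_right, sub_pos]
      rfl
  rw [hL, ← Ang_reorder P Q]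
  have hexp : ∀ g, (F g - 1 / 2) ^ 2 = F g ^ 2 - F g + 1 / 4 := fun g => by ring
  simp_rw [hexp]
  rw [integral_add (f := fun g => F g ^ 2 - F g) (hFi2.sub hFi) (integrable_const _), integral_sub hFi2 hFi, hInt1, hInt2]
  simp
  ring
end
end

section
/- Let P_{XY} be a Borel probability measure on ℝ^p × ℝ^q and let (X1,Y1), …, (X4,Y4) be i.i.d. with law P_{XY}; assume P(X1 = X2) = 0 and P(Y1 = Y2) = 0. Then ∫_{S^{p−1}} ∫_{S^{q−1}} [ 4·P( ⟨α, X1 − X2⟩ < 0 and ⟨β, Y1 − Y2⟩ < 0 ) − 1 ]² dλ_q(β) dλ_p(α) = E[ (2 − (2/π)·Ang(X1 − X2, X3 − X4)) · (2 − (2/π)·Ang(Y1 − Y2, Y3 − Y4)) ] − 1, where inside the probability (X1,Y1), (X2,Y2) are two independent draws from P_{XY}. -/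
open MeasureTheory ProbabilityTheory Real
open scoped RealInnerProductSpace ENNReal BigOperators

noncomputable section

lemma meas_two {X : Type*} [MeasurableSpace X] (f g : X → ℝ) (hf : Measurable f)
    (hg : Measurable g) : MeasurableSet {x | f x < 0 ∧ g x < 0} :=
  (measurableSet_lt hf measurable_const).inter (measurableSet_lt hg measurable_const)

lemma std_eq (d : ℕ) : _root_.stdGaussian d
    = ProbabilityTheory.stdGaussian (EuclideanSpace ℝ (Fin d)) := by
  rw [← map_pi_eq_stdGaussian]; rfl

instance (d : ℕ) : IsProbabilityMeasure (_root_.stdGaussian d) := by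
  rw [std_eq]; infer_instance

lemma meas_normalize (d : ℕ) :
    Measurable (fun x : EuclideanSpace ℝ (Fin d) => ‖x‖⁻¹ • x) := by fun_prop

instance (d : ℕ) : IsProbabilityMeasure (sphereUniform d) :=
  Measure.isProbabilityMeasure_map (meas_normalize d).aemeasurable

lemma law2 {d : ℕ} (u v : EuclideanSpace ℝ (Fin d)) (hu : ‖u‖ = 1) (hv : ‖v‖ = 1) (θ : ℝ)
    (h : ⟪u, v⟫ = cos θ) :
    (_root_.stdGaussian d).map (fun x => (⟪u, x⟫, ⟪v, x⟫)) =
      ((gaussianReal 0 1).prod (gaussianReal 0 1)).map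
        (fun w : ℝ × ℝ => (w.1, cos θ * w.1 + sin θ * w.2)) := by
  have m1 : Measurable (fun x : EuclideanSpace ℝ (Fin d) => (⟪u, x⟫, ⟪v, x⟫)) := by fun_prop
  have m2 : Measurable (fun w : ℝ × ℝ => (w.1, cos θ * w.1 + sin θ * w.2)) := by fun_prop
  have := Measure.isProbabilityMeasure_map (μ := _root_.stdGaussian d) m1.aemeasurable
  have := Measure.isProbabilityMeasure_map
    (μ := (gaussianReal 0 1).prod (gaussianReal 0 1)) m2.aemeasurable
  apply Measure.ext_of_charFunDual
  ext T
  have hT : ∀ a b : ℝ, T (a, b) = a * T (1, 0) + b * T (0, 1) := by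
    intro a b
    have : ((a, b) : ℝ × ℝ) = a • ((1 : ℝ), (0 : ℝ)) + b • ((0 : ℝ), (1 : ℝ)) := by simp
    rw [this, map_add, map_smul, map_smul]; simp
  rw [charFunDual_apply, charFunDual_apply, integral_map m1.aemeasurable (by fun_prop),
    integral_map m2.aemeasurable (by fun_prop)]
  generalize T (1, 0) = c at hT
  generalize T (0, 1) = e at hT
  have e1 : ∀ x : EuclideanSpace ℝ (Fin d), T (⟪u, x⟫, ⟪v, x⟫) = ⟪x, c • u + e • v⟫ := by
    intro x
    rw [hT, inner_add_right, inner_smul_right, inner_smul_right, real_inner_comm u,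
      real_inner_comm v]; ring
  have e2 : ∀ w : ℝ × ℝ, Complex.exp ((T (w.1, cos θ * w.1 + sin θ * w.2) : ℝ) * Complex.I)
      = Complex.exp ((c + e * cos θ : ℝ) * w.1 * Complex.I)
        * Complex.exp ((e * sin θ : ℝ) * w.2 * Complex.I) := by
    intro w
    rw [hT, ← Complex.exp_add]; push_cast; ring_nf
  simp_rw [e1, e2]
  rw [integral_prod_mul (fun x : ℝ => Complex.exp ((c + e * cos θ : ℝ) * x * Complex.I))
    (fun x : ℝ => Complex.exp ((e * sin θ : ℝ) * x * Complex.I)),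
    ← charFun_apply_real, ← charFun_apply_real, ← charFun_apply, std_eq, charFun_stdGaussian,
    charFun_gaussianReal, charFun_gaussianReal, ← Complex.exp_add]
  have : ‖c • u + e • v‖ ^ 2 = (c + e * cos θ) ^ 2 + (e * sin θ) ^ 2 := by
    rw [norm_add_sq_real, norm_smul, norm_smul, inner_smul_left, inner_smul_right, h, hu, hv]
    simp only [mul_one, norm_eq_abs, sq_abs, conj_trivial]
    linear_combination (-e ^ 2) * sin_sq_add_cos_sq θ
  congr 1
  rw [← Complex.ofReal_pow, this]
  push_cast
  ring_nf

lemma cone_measure : ∃ K : ℝ≥0∞, ∀ S : Set (ℝ × ℝ), MeasurableSet S →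
    ∀ A : Set ℝ, MeasurableSet A →
    (∀ r φ : ℝ, 0 < r → φ ∈ Set.Ioo (-π) π → ((r * cos φ, r * sin φ) ∈ S ↔ φ ∈ A)) →
    (gaussianReal 0 1).prod (gaussianReal 0 1) S = K * volume (A ∩ Set.Ioo (-π) π) := by
  refine ⟨∫⁻ r in Set.Ioi (0:ℝ), ENNReal.ofReal (r * ((√(2 * π))⁻¹ ^ 2 * exp (- r ^ 2 / 2))), ?_⟩
  intro S hS A hA hSA
  rw [gaussianReal_of_var_ne_zero 0 (one_ne_zero), prod_withDensity (by fun_prop) (by fun_prop),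
    withDensity_apply _ hS, ← lintegral_indicator hS, ← Measure.volume_eq_prod,
    ← lintegral_comp_polarCoord_symm]
  have : ∀ p ∈ polarCoord.target, ENNReal.ofReal p.1 • S.indicator
      (fun a : ℝ × ℝ => gaussianPDF 0 1 a.1 * gaussianPDF 0 1 a.2) (polarCoord.symm p) =
      ENNReal.ofReal (p.1 * ((√(2 * π))⁻¹ ^ 2 * exp (- p.1 ^ 2 / 2))) *
       A.indicator (fun _ => (1 : ℝ≥0∞)) p.2 := by
    rintro ⟨r, φ⟩ hp
    simp only [polarCoord_target, Set.mem_prod, Set.mem_Ioi] at hp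
    simp only [polarCoord_symm_apply]
    by_cases hφ : φ ∈ A
    · rw [Set.indicator_of_mem ((hSA r φ hp.1 hp.2).2 hφ), Set.indicator_of_mem hφ, mul_one,
        gaussianPDF, gaussianPDF, ← ENNReal.ofReal_mul (gaussianPDFReal_nonneg _ _ _), smul_eq_mul,
        ← ENNReal.ofReal_mul hp.1.le, gaussianPDFReal, gaussianPDFReal]
      congr 2
      rw [mul_mul_mul_comm, ← exp_add, ← pow_two]
      simp only [NNReal.coe_one, mul_one, sub_zero]
      congr 2
      linear_combination (- r ^ 2 / 2) * sin_sq_add_cos_sq φ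
    · rw [Set.indicator_of_notMem (fun h => hφ ((hSA r φ hp.1 hp.2).1 h)),
        Set.indicator_of_notMem hφ]; simp
  rw [setLIntegral_congr_fun polarCoord.open_target.measurableSet this, polarCoord_target,
    Measure.volume_eq_prod, ← Measure.prod_restrict,
    lintegral_prod_mul
      (f := fun r : ℝ => ENNReal.ofReal (r * ((√(2 * π))⁻¹ ^ 2 * exp (- r ^ 2 / 2))))
      (g := A.indicator (fun _ => (1 : ℝ≥0∞))) (by fun_prop)
      (measurable_const.indicator hA).aemeasurable]
  congr 1
  change ∫⁻ a, A.indicator 1 a ∂_ = _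
  rw [lintegral_indicator_one hA, Measure.restrict_apply hA]

lemma cone_measure' (S : Set (ℝ × ℝ)) (hS : MeasurableSet S)
    (A : Set ℝ) (hA : MeasurableSet A)
    (h : ∀ r φ : ℝ, 0 < r → φ ∈ Set.Ioo (-π) π → ((r * cos φ, r * sin φ) ∈ S ↔ φ ∈ A)) :
    ((gaussianReal 0 1).prod (gaussianReal 0 1) S).toReal
      = (volume (A ∩ Set.Ioo (-π) π)).toReal / (2 * π) := by
  obtain ⟨K, hK⟩ := cone_measure
  have h1 := hK Set.univ MeasurableSet.univ Set.univ MeasurableSet.univ (by simp)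
  rw [measure_univ, Set.univ_inter, Real.volume_Ioo] at h1
  have h2 := congrArg ENNReal.toReal h1
  rw [ENNReal.toReal_mul, ENNReal.toReal_ofReal (by linarith [pi_pos]), ENNReal.toReal_one] at h2
  rw [hK S hS A hA h, ENNReal.toReal_mul, eq_div_iff (by positivity)]
  linear_combination (- (volume (A ∩ Set.Ioo (-π) π)).toReal) * h2

lemma sector (θ : ℝ) (h0 : 0 ≤ θ) (h1 : θ ≤ π) :
    ((gaussianReal 0 1).prod (gaussianReal 0 1)
      {w : ℝ × ℝ | w.1 < 0 ∧ cos θ * w.1 + sin θ * w.2 < 0}).toReal = (π - θ) / (2 * π) := by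
  have hpi := pi_pos
  rw [cone_measure' _ _ (Set.Ioo (θ + π / 2) π ∪ Set.Ioo (max (-π) (θ - 3 * π / 2)) (-(π / 2)))
    (by measurability)]
  · congr 1
    rw [Set.inter_eq_left.2, measure_union _ measurableSet_Ioo, Real.volume_Ioo, Real.volume_Ioo]
    · rw [ENNReal.toReal_add (by simp) (by simp), ENNReal.toReal_ofReal', ENNReal.toReal_ofReal']
      grind
    · rw [Set.disjoint_left]
      intro x hx hx'
      simp only [Set.mem_Ioo] at hx hx'
      linarith
    · intro x hx
      simp only [Set.mem_union, Set.mem_Ioo, max_lt_iff] at hx ⊢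
      rcases hx with hx | hx <;> constructor <;> linarith
  · intro r φ hr hφ
    have e : cos θ * (r * cos φ) + sin θ * (r * sin φ) = r * cos (φ - θ) := by
      rw [cos_sub]; ring
    have hm : ∀ x : ℝ, r * x < 0 ↔ x < 0 := fun x => by
      constructor
      · intro h; by_contra h'; nlinarith
      · intro h; nlinarith
    simp only [Set.mem_ofPred_eq, Set.mem_union, Set.mem_Ioo, max_lt_iff] at hφ ⊢
    rw [e, hm _, hm _]
    rcases lt_or_ge (π / 2) φ with h | h
    · have c1 := cos_neg_of_pi_div_two_lt_of_lt h (by linarith)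
      constructor
      · rintro ⟨-, h2⟩
        left
        refine ⟨?_, hφ.2⟩
        by_contra h3
        linarith [cos_nonneg_of_neg_pi_div_two_le_of_le (x := φ - θ) (by linarith) (by linarith)]
      · rintro (h2 | h2)
        · exact ⟨c1, cos_neg_of_pi_div_two_lt_of_lt (by linarith) (by linarith)⟩
        · linarith
    rcases lt_or_ge φ (-(π / 2)) with h' | h'
    · have c1 : cos φ < 0 := by
        rw [← cos_add_two_pi]
        exact cos_neg_of_pi_div_two_lt_of_lt (by linarith) (by linarith)
      rw [← cos_add_two_pi (φ - θ)]
      constructor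
      · rintro ⟨-, h2⟩
        right
        refine ⟨⟨hφ.1, ?_⟩, h'⟩
        by_contra h3
        linarith [cos_nonneg_of_neg_pi_div_two_le_of_le (x := φ - θ + 2 * π)
          (by linarith) (by linarith)]
      · rintro (h2 | h2)
        · linarith
        · exact ⟨c1, cos_neg_of_pi_div_two_lt_of_lt (by linarith) (by linarith)⟩
    · constructor
      · rintro ⟨h1, -⟩
        linarith [cos_nonneg_of_neg_pi_div_two_le_of_le (x := φ) (by linarith) (by linarith)]
      · rintro (h2 | h2) <;> linarith
  · exact meas_two _ _ (by fun_prop) (by fun_prop)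

lemma quad_sphere {d : ℕ} (u v : EuclideanSpace ℝ (Fin d)) (hu : u ≠ 0) (hv : v ≠ 0) :
    (sphereUniform d {α | ⟪α, u⟫ < 0 ∧ ⟪α, v⟫ < 0}).toReal = (π - Ang u v) / (2 * π) := by
  have hu' : 0 < ‖u‖ := norm_pos_iff.2 hu
  have hv' : 0 < ‖v‖ := norm_pos_iff.2 hv
  have nu : ‖‖u‖⁻¹ • u‖ = 1 := by rw [norm_smul, norm_inv, norm_norm, inv_mul_cancel₀ hu'.ne']
  have nv : ‖‖v‖⁻¹ • v‖ = 1 := by rw [norm_smul, norm_inv, norm_norm, inv_mul_cancel₀ hv'.ne']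
  have hc : ⟪‖u‖⁻¹ • u, ‖v‖⁻¹ • v⟫ = cos (Ang u v) := by
    have := abs_le.1 (abs_real_inner_div_norm_mul_norm_le_one u v)
    rw [Ang, cos_arccos this.1 this.2, real_inner_smul_left, real_inner_smul_right]
    field_simp
  have hl := law2 _ _ nu nv _ hc
  have key := sector (Ang u v) (arccos_nonneg _) (arccos_le_pi _)
  have m0 : MeasurableSet {w : ℝ × ℝ | w.1 < 0 ∧ w.2 < 0} :=
    meas_two _ _ (by fun_prop) (by fun_prop)
  have h2 := congrArg (fun m => m {w : ℝ × ℝ | w.1 < 0 ∧ w.2 < 0}) hl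
  rw [Measure.map_apply (by fun_prop) m0, Measure.map_apply (by fun_prop) m0] at h2
  rw [← key, sphereUniform, Measure.map_apply (meas_normalize d)
    (meas_two _ _ (by fun_prop) (by fun_prop))]
  simp only [Set.preimage_ofPred_eq] at h2 ⊢
  rw [← h2]
  congr 2
  ext x
  have aux : ∀ w : EuclideanSpace ℝ (Fin d), w ≠ 0 →
      (⟪‖x‖⁻¹ • x, w⟫ < 0 ↔ ⟪‖w‖⁻¹ • w, x⟫ < 0) := by
    intro w hw
    rw [real_inner_smul_left, real_inner_smul_left, real_inner_comm]
    have hw' : 0 < ‖w‖⁻¹ := inv_pos.2 (norm_pos_iff.2 hw)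
    by_cases hx : x = 0
    · simp [hx]
    have hx' : 0 < ‖x‖⁻¹ := inv_pos.2 (norm_pos_iff.2 hx)
    simp only [mul_neg_iff, hx', hw', hx'.not_gt, hw'.not_gt, true_and, false_and, or_false]
  simp only [Set.mem_ofPred_eq, aux u hu, aux v hv]

lemma half_sphere {d : ℕ} (u : EuclideanSpace ℝ (Fin d)) (hu : u ≠ 0) :
    (sphereUniform d {α | ⟪α, u⟫ < 0}).toReal = 1 / 2 := by
  have := quad_sphere u u hu hu
  simp only [and_self] at this
  rw [this, Ang, real_inner_self_eq_norm_mul_norm, div_self, arccos_one]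
  · have := pi_pos; field_simp; ring
  · simpa using hu

/-- indicator of `⟪a, u⟫ < 0`. -/
def ngi {d : ℕ} (a u : EuclideanSpace ℝ (Fin d)) : ℝ := if ⟪a, u⟫ < 0 then 1 else 0

lemma measurable_ngi {d : ℕ} : Measurable
    (fun x : EuclideanSpace ℝ (Fin d) × EuclideanSpace ℝ (Fin d) => ngi x.1 x.2) := by
  unfold ngi
  exact Measurable.ite (measurableSet_lt (by fun_prop) measurable_const)
    measurable_const measurable_const

@[fun_prop]
lemma measurable_ngi' {d : ℕ} {X : Type*} [MeasurableSpace X] {f g : X → EuclideanSpace ℝ (Fin d)}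
    (hf : Measurable f) (hg : Measurable g) : Measurable (fun x => ngi (f x) (g x)) :=
  measurable_ngi.comp (hf.prodMk hg)

lemma ngi_nonneg {d : ℕ} (a u : EuclideanSpace ℝ (Fin d)) : 0 ≤ ngi a u := by
  unfold ngi; split_ifs <;> simp

lemma ngi_le {d : ℕ} (a u : EuclideanSpace ℝ (Fin d)) : ngi a u ≤ 1 := by
  unfold ngi; split_ifs <;> simp

lemma int_ngi {d : ℕ} (u : EuclideanSpace ℝ (Fin d)) (hu : u ≠ 0) :
    ∫ α, ngi α u ∂(sphereUniform d) = 1 / 2 := by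
  rw [← half_sphere u hu]
  have m : MeasurableSet {α | ⟪α, u⟫ < 0} := measurableSet_lt (by fun_prop) measurable_const
  rw [← measureReal_def, ← integral_indicator_one m]
  congr 1

lemma int_ngi2 {d : ℕ} (u v : EuclideanSpace ℝ (Fin d)) (hu : u ≠ 0) (hv : v ≠ 0) :
    ∫ α, ngi α u * ngi α v ∂(sphereUniform d) = (π - Ang u v) / (2 * π) := by
  rw [← quad_sphere u v hu hv]
  have m : MeasurableSet {α | ⟪α, u⟫ < 0 ∧ ⟪α, v⟫ < 0} :=
    meas_two _ _ (by fun_prop) (by fun_prop)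
  rw [← measureReal_def, ← integral_indicator_one m]
  congr 1
  ext α
  simp only [ngi, Set.indicator, Set.mem_ofPred_eq, Pi.one_apply]
  split_ifs <;> simp_all

lemma measurable_Ang_s16 {d : ℕ} {X : Type*} [MeasurableSpace X] {f g : X → EuclideanSpace ℝ (Fin d)}
    (hf : Measurable f) (hg : Measurable g) : Measurable (fun x => Ang (f x) (g x)) := by
  unfold Ang
  exact measurable_arccos.comp ((hf.inner hg).div (hf.norm.mul hg.norm))

lemma integrable_bdd {X : Type*} [MeasurableSpace X] (m : Measure X) [IsProbabilityMeasure m]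
    (f : X → ℝ) (hf : Measurable f) (C : ℝ) (h : ∀ x, |f x| ≤ C) : Integrable f m :=
  Integrable.of_bound hf.aestronglyMeasurable C (Filter.Eventually.of_forall h)

lemma kern_bdd {d : ℕ} (u v : EuclideanSpace ℝ (Fin d)) :
    |2 - (2 / π) * Ang u v| ≤ 2 := by
  have h1 : 0 ≤ Ang u v := arccos_nonneg _
  have h2 : Ang u v ≤ π := arccos_le_pi _
  have : 2 / π * Ang u v ≤ 2 := by
    rw [div_mul_eq_mul_div, div_le_iff₀ pi_pos]; linarith
  have : 0 ≤ 2 / π * Ang u v := by positivity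
  rw [abs_le]; constructor <;> linarith

lemma square_fubini {A W : Type*} [MeasurableSpace A] [MeasurableSpace W]
    (lam : Measure A) (ν : Measure W) [IsProbabilityMeasure lam] [IsProbabilityMeasure ν]
    (G : A → W → ℝ) (mG : Measurable (fun x : A × W => G x.1 x.2))
    (bG : ∀ a w, |G a w| ≤ 1) :
    Integrable (fun a => (4 * (∫ w, G a w ∂ν) - 1) ^ 2) lam ∧
    ∫ a, (4 * (∫ w, G a w ∂ν) - 1) ^ 2 ∂lam =
      16 * (∫ w, ∫ w', ∫ a, G a w * G a w' ∂lam ∂ν ∂ν) - 8 * (∫ w, ∫ a, G a w ∂lam ∂ν) + 1 := by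
  have mQ : Measurable (fun a => ∫ w, G a w ∂ν) :=
    mG.stronglyMeasurable.integral_prod_right.measurable
  have bQ : ∀ a, |∫ w, G a w ∂ν| ≤ 1 := by
    intro a
    have := norm_integral_le_of_norm_le_const (μ := ν) (f := G a) (C := 1)
      (Filter.Eventually.of_forall (bG a))
    simpa using this
  have E1 : ∫ a, ∫ w, G a w ∂ν ∂lam = ∫ w, ∫ a, G a w ∂lam ∂ν :=
    integral_integral_swap (integrable_bdd _ _ mG 1 fun x => bG _ _)
  have E2 : ∫ a, (∫ w, G a w ∂ν) ^ 2 ∂lam = ∫ w, ∫ w', ∫ a, G a w * G a w' ∂lam ∂ν ∂ν := by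
    have s1 : ∀ a, (∫ w, G a w ∂ν) ^ 2 = ∫ x : W × W, G a x.1 * G a x.2 ∂(ν.prod ν) := by
      intro a
      rw [integral_prod_mul (G a) (G a), pow_two]
    have i1 : Integrable (fun y : A × (W × W) => G y.1 y.2.1 * G y.1 y.2.2)
        (lam.prod (ν.prod ν)) := by
      refine integrable_bdd _ _ ?_ 1 fun y => ?_
      · refine Measurable.mul ?_ ?_
        · exact mG.comp (measurable_fst.prodMk (measurable_fst.comp measurable_snd))
        · exact mG.comp (measurable_fst.prodMk (measurable_snd.comp measurable_snd))
      · rw [abs_mul]; exact mul_le_one₀ (bG _ _) (abs_nonneg _) (bG _ _)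
    simp_rw [s1]
    rw [integral_integral_swap (f := fun a (x : W × W) => G a x.1 * G a x.2) i1]
    exact integral_prod _ i1.integral_prod_right
  generalize hQ : (fun a => ∫ w, G a w ∂ν) = Q at mQ
  have hQ' : ∀ a, ∫ w, G a w ∂ν = Q a := fun a => congrFun hQ a
  simp_rw [hQ'] at bQ E1 E2 ⊢
  have iQ : Integrable Q lam := integrable_bdd _ _ mQ 1 bQ
  have iQ2 : Integrable (fun a => Q a ^ 2) lam :=
    integrable_bdd _ _ (mQ.pow_const 2) 1 fun a => by
      rw [abs_pow]; exact pow_le_one₀ (abs_nonneg _) (bQ a)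
  have this : ∀ a, (4 * Q a - 1) ^ 2 = 16 * Q a ^ 2 - 8 * Q a + 1 := fun a => by ring
  simp_rw [this]
  have i3 : Integrable (fun a => 16 * Q a ^ 2 - 8 * Q a) lam :=
    (iQ2.const_mul 16).sub (iQ.const_mul 8)
  refine ⟨i3.add (integrable_const _), ?_⟩
  rw [integral_add i3 (integrable_const _),
    integral_sub (iQ2.const_mul 16) (iQ.const_mul 8), integral_const_mul, integral_const_mul,
    E1, E2]
  simp

lemma four_fubini {Z : Type*} [MeasurableSpace Z] (μ : Measure Z) [IsProbabilityMeasure μ]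
    (F : Z × Z → Z × Z → ℝ) (mF : Measurable (fun x : (Z × Z) × (Z × Z) => F x.1 x.2))
    (C : ℝ) (bF : ∀ w w', |F w w'| ≤ C) :
    ∫ z1, ∫ z2, ∫ z3, ∫ z4, F (z1, z2) (z3, z4) ∂μ ∂μ ∂μ ∂μ
      = ∫ w, ∫ w', F w w' ∂(μ.prod μ) ∂(μ.prod μ) := by
  have iF : Integrable (fun x : (Z × Z) × (Z × Z) => F x.1 x.2) ((μ.prod μ).prod (μ.prod μ)) :=
    integrable_bdd _ _ mF C fun x => bF _ _
  rw [integral_prod _ iF.integral_prod_left]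
  refine integral_congr_ae (Filter.Eventually.of_forall fun z1 => ?_)
  refine integral_congr_ae (Filter.Eventually.of_forall fun z2 => ?_)
  have : Integrable (fun w' => F (z1, z2) w') (μ.prod μ) :=
    integrable_bdd _ _ (mF.comp measurable_prodMk_left) C fun x => bF _ _
  exact (integral_prod _ this).symm

/-- the sample space. -/
abbrev ZZ (p q : ℕ) : Type := EuclideanSpace ℝ (Fin p) × EuclideanSpace ℝ (Fin q)

/-- the angular kernel. -/
def FF (p q : ℕ) (w w' : ZZ p q × ZZ p q) : ℝ :=
  (2 - (2 / π) * Ang (w.1.1 - w.2.1) (w'.1.1 - w'.2.1))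
    * (2 - (2 / π) * Ang (w.1.2 - w.2.2) (w'.1.2 - w'.2.2))

/-- the joint indicator. -/
def GG (p q : ℕ) (a : ZZ p q) (w : ZZ p q × ZZ p q) : ℝ :=
  ngi a.1 (w.1.1 - w.2.1) * ngi a.2 (w.1.2 - w.2.2)

lemma measurable_FF (p q : ℕ) :
    Measurable (fun x : (ZZ p q × ZZ p q) × (ZZ p q × ZZ p q) => FF p q x.1 x.2) := by
  have a1 : Measurable (fun x : (ZZ p q × ZZ p q) × (ZZ p q × ZZ p q) =>
      Ang (x.1.1.1 - x.1.2.1) (x.2.1.1 - x.2.2.1)) :=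
    measurable_Ang_s16 (by fun_prop) (by fun_prop)
  have a2 : Measurable (fun x : (ZZ p q × ZZ p q) × (ZZ p q × ZZ p q) =>
      Ang (x.1.1.2 - x.1.2.2) (x.2.1.2 - x.2.2.2)) :=
    measurable_Ang_s16 (by fun_prop) (by fun_prop)
  exact (measurable_const.sub (measurable_const.mul a1)).mul
    (measurable_const.sub (measurable_const.mul a2))

lemma FF_bdd (p q : ℕ) (w w' : ZZ p q × ZZ p q) : |FF p q w w'| ≤ 4 := by
  rw [FF, abs_mul]
  calc _ ≤ (2 : ℝ) * 2 := mul_le_mul (kern_bdd _ _) (kern_bdd _ _) (abs_nonneg _) (by norm_num)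
    _ = 4 := by norm_num

lemma measurable_GG (p q : ℕ) :
    Measurable (fun x : ZZ p q × (ZZ p q × ZZ p q) => GG p q x.1 x.2) := by
  refine Measurable.mul ?_ ?_
  · exact measurable_ngi' (by fun_prop) (by fun_prop)
  · exact measurable_ngi' (by fun_prop) (by fun_prop)

lemma GG_bdd (p q : ℕ) (a : ZZ p q) (w : ZZ p q × ZZ p q) : |GG p q a w| ≤ 1 := by
  rw [GG, abs_of_nonneg (mul_nonneg (ngi_nonneg _ _) (ngi_nonneg _ _))]
  exact mul_le_one₀ (ngi_le _ _) (ngi_nonneg _ _) (ngi_le _ _)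

lemma GG_int {p q : ℕ} (w : ZZ p q × ZZ p q) (h1 : w.1.1 - w.2.1 ≠ 0) (h2 : w.1.2 - w.2.2 ≠ 0) :
    ∫ a, GG p q a w ∂((sphereUniform p).prod (sphereUniform q)) = 1 / 4 := by
  unfold GG
  rw [integral_prod_mul (fun a => ngi a (w.1.1 - w.2.1))
    (fun b => ngi b (w.1.2 - w.2.2)), int_ngi _ h1, int_ngi _ h2]
  norm_num

lemma GG_int2 {p q : ℕ} (w w' : ZZ p q × ZZ p q) (h1 : w.1.1 - w.2.1 ≠ 0)
    (h2 : w.1.2 - w.2.2 ≠ 0) (h1' : w'.1.1 - w'.2.1 ≠ 0) (h2' : w'.1.2 - w'.2.2 ≠ 0) :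
    ∫ a, GG p q a w * GG p q a w' ∂((sphereUniform p).prod (sphereUniform q))
      = FF p q w w' / 16 := by
  have : ∀ a : ZZ p q, GG p q a w * GG p q a w' =
      (ngi a.1 (w.1.1 - w.2.1) * ngi a.1 (w'.1.1 - w'.2.1)) *
      (ngi a.2 (w.1.2 - w.2.2) * ngi a.2 (w'.1.2 - w'.2.2)) := by
    intro a; simp only [GG]; ring
  simp_rw [this]
  rw [integral_prod_mul (fun a => ngi a (w.1.1 - w.2.1) * ngi a (w'.1.1 - w'.2.1))
    (fun a => ngi a (w.1.2 - w.2.2) * ngi a (w'.1.2 - w'.2.2)),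
    int_ngi2 _ _ h1 h1', int_ngi2 _ _ h2 h2', FF]
  have := pi_pos
  field_simp
  ring

/-- Theorem 7.1, projection-averaged Kendall's tau: for a joint law `μ` on
`ℝ^p × ℝ^q` with `P(X₁ = X₂) = 0` and `P(Y₁ = Y₂) = 0`,
`∫_{S^{p-1}} ∫_{S^{q-1}} [4 P(⟪α,X₁-X₂⟫ < 0, ⟪β,Y₁-Y₂⟫ < 0) - 1]² dλ_q(β) dλ_p(α)
  = E[(2 - (2/π) Ang(X₁-X₂, X₃-X₄)) (2 - (2/π) Ang(Y₁-Y₂, Y₃-Y₄))] - 1`,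
with `(X₁,Y₁),…,(X₄,Y₄)` i.i.d. from `μ` (expectations written as iterated integrals). -/
theorem stmt16 {p q : ℕ}
    (μ : Measure (EuclideanSpace ℝ (Fin p) × EuclideanSpace ℝ (Fin q)))
    [IsProbabilityMeasure μ]
    (hX : (μ.prod μ) {w | w.1.1 = w.2.1} = 0)
    (hY : (μ.prod μ) {w | w.1.2 = w.2.2} = 0) :
    (∫ α, ∫ β,
        (4 * ((μ.prod μ)
            {w | ⟪α, w.1.1 - w.2.1⟫ < 0 ∧ ⟪β, w.1.2 - w.2.2⟫ < 0}).toReal - 1) ^ 2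
      ∂(sphereUniform q) ∂(sphereUniform p))
    = (∫ z1, ∫ z2, ∫ z3, ∫ z4,
          (2 - (2 / π) * Ang (z1.1 - z2.1) (z3.1 - z4.1))
            * (2 - (2 / π) * Ang (z1.2 - z2.2) (z3.2 - z4.2)) ∂μ ∂μ ∂μ ∂μ) - 1 := by
  have nX : ∀ᵐ w ∂(μ.prod μ), w.1.1 - w.2.1 ≠ 0 := by
    rw [ae_iff]; simpa [sub_eq_zero] using hX
  have nY : ∀ᵐ w ∂(μ.prod μ), w.1.2 - w.2.2 ≠ 0 := by
    rw [ae_iff]; simpa [sub_eq_zero] using hY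
  have P : ∀ α β, ((μ.prod μ) {w | ⟪α, w.1.1 - w.2.1⟫ < 0 ∧ ⟪β, w.1.2 - w.2.2⟫ < 0}).toReal
      = ∫ w, GG p q (α, β) w ∂(μ.prod μ) := by
    intro α β
    have m : MeasurableSet {w : ZZ p q × ZZ p q |
        ⟪α, w.1.1 - w.2.1⟫ < 0 ∧ ⟪β, w.1.2 - w.2.2⟫ < 0} :=
      meas_two _ _ (by fun_prop) (by fun_prop)
    rw [← measureReal_def, ← integral_indicator_one m]
    congr 1
    ext w
    simp only [GG, ngi, Set.indicator, Set.mem_ofPred_eq, Pi.one_apply]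
    split_ifs <;> simp_all
  obtain ⟨hint, hsq⟩ := square_fubini ((sphereUniform p).prod (sphereUniform q)) (μ.prod μ)
    (GG p q) (measurable_GG p q) (GG_bdd p q)
  have hfour := four_fubini μ (FF p q) (measurable_FF p q) 4 (FF_bdd p q)
  have E1 : ∫ w, ∫ a, GG p q a w ∂((sphereUniform p).prod (sphereUniform q)) ∂(μ.prod μ)
      = 1 / 4 := by
    have : ∀ᵐ w ∂(μ.prod μ), ∫ a, GG p q a w ∂((sphereUniform p).prod (sphereUniform q))
        = 1 / 4 := by
      filter_upwards [nX, nY] with w h1 h2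
      exact GG_int w h1 h2
    rw [integral_congr_ae this]; simp
  have E2 : ∫ w, ∫ w', ∫ a, GG p q a w * GG p q a w' ∂((sphereUniform p).prod (sphereUniform q))
        ∂(μ.prod μ) ∂(μ.prod μ)
      = (∫ w, ∫ w', FF p q w w' ∂(μ.prod μ) ∂(μ.prod μ)) / 16 := by
    rw [← integral_div]
    refine integral_congr_ae ?_
    filter_upwards [nX, nY] with w h1 h2
    rw [← integral_div]
    refine integral_congr_ae ?_
    filter_upwards [nX, nY] with w' h1' h2'
    exact GG_int2 w w' h1 h2 h1' h2'
  rw [integral_prod _ hint, E1, E2, ← hfour] at hsq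
  simp_rw [P]
  rw [hsq]
  simp only [FF]
  ring
end
end
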